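/- arXiv:2504.20027 — 7 statements merged into one kernel-verified Lean document; each statement's English description precedes it below -/
import Mathlib

section
/- Let G be a digraph, let k be a positive integer, and let S, T ⊆ V(G) be disjoint nonempty sets. Then the number of distinct sets X ⊆ V(G) such that X is an important A-B separator of size at most k for some A ⊆ S and some B ⊆ T is at most 4^k · C(|S|, ≤k) · C(|T|, ≤2k). -/
/-- A digraph on vertex type `V` is given by its arc relation `E : V → V → Prop`.
`RSet E S X` is the set of vertices reachable in `G∖X` by a directed path from
some vertex of `S∖X` (every vertex of `S∖X` reaches itself). -/
def RSet {V : Type*} (E : V → V → Prop) (S X : Finset V) : Set V :=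
  {v | ∃ s ∈ S, s ∉ X ∧ Relation.ReflTransGen (fun a b => E a b ∧ b ∉ X) s v}

/-- `X` is an `A`-`B` separator: in `G∖X` no vertex of `B∖X` is reachable from `A∖X`. -/
def IsSep {V : Type*} (E : V → V → Prop) (A B X : Finset V) : Prop :=
  ∀ b ∈ B, b ∉ RSet E A X

/-- `X` is a minimal `A`-`B` separator. -/
def IsMinSep {V : Type*} [DecidableEq V] (E : V → V → Prop) (A B X : Finset V) : Prop :=
  IsSep E A B X ∧ ∀ v ∈ X, ¬ IsSep E A B (X.erase v)

/-- `X` is an important `A`-`B` separator. -/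
def IsImpSep {V : Type*} [DecidableEq V] (E : V → V → Prop) (A B X : Finset V) : Prop :=
  IsMinSep E A B X ∧
    ¬ ∃ X' : Finset V, IsSep E A B X' ∧ X'.card ≤ X.card ∧ RSet E A X ⊂ RSet E A X'

/-- `prefBinom x c = C(x, ≤c) = Σ_{i=1}^{c} binom(x, i)`. -/
def prefBinom (x c : ℕ) : ℕ := ∑ i ∈ Finset.Icc 1 c, Nat.choose x i

open Classical in
/-- The vertices outside `D ∪ R` that lie in `A` or receive an arc from `R`: the out-boundary
of `R` in the digraph with vertices `D` deleted and a source attached to `A`. -/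
noncomputable def outBd {V : Type*} [Fintype V] (E : V → V → Prop) (A D R : Finset V) :
    Finset V :=
  Finset.univ.filter fun v => v ∉ D ∧ v ∉ R ∧ (v ∈ A ∨ ∃ u ∈ R, E u v)

open Classical in
/-- `RSet` as a finset. -/
noncomputable def reach {V : Type*} [Fintype V] (E : V → V → Prop) (A X : Finset V) :
    Finset V :=
  Finset.univ.filter fun v => v ∈ RSet E A X

section

variable {V : Type*} [Fintype V] {E : V → V → Prop}

lemma mem_outBd {A D R : Finset V} {v : V} :
    v ∈ outBd E A D R ↔ v ∉ D ∧ v ∉ R ∧ (v ∈ A ∨ ∃ u ∈ R, E u v) := by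
  simp [outBd]

lemma mem_reach {A X : Finset V} {v : V} : v ∈ reach E A X ↔ v ∈ RSet E A X := by
  simp [reach]

lemma disjoint_reach_iff {A B X : Finset V} : Disjoint (reach E A X) B ↔ IsSep E A B X := by
  rw [Finset.disjoint_right]
  simp only [mem_reach, IsSep]

lemma disjoint_reach_self {A X : Finset V} : Disjoint (reach E A X) X := by
  rw [Finset.disjoint_left]
  intro v hv
  obtain ⟨s, -, hs, h⟩ := mem_reach.1 hv
  induction h with
  | refl => exact hs
  | tail _ h _ => exact h.2

lemma disjoint_outBd {A D R : Finset V} : Disjoint R (outBd E A D R) :=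
  Finset.disjoint_right.2 fun _ hv => (mem_outBd.1 hv).2.1

lemma outBd_reach_subset {A X : Finset V} : outBd E A ∅ (reach E A X) ⊆ X := by
  intro v hv
  obtain ⟨-, hv, h⟩ := mem_outBd.1 hv
  by_contra hX
  apply hv
  rw [mem_reach]
  rcases h with h | ⟨u, hu, h⟩
  · exact ⟨v, h, hX, .refl⟩
  · obtain ⟨s, hs, hsX, hr⟩ := mem_reach.1 hu
    exact ⟨s, hs, hsX, hr.tail ⟨h, hX⟩⟩

lemma reach_subset_of_outBd_subset {A X R : Finset V} (h : outBd E A ∅ R ⊆ X) :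
    reach E A X ⊆ R := by
  intro v hv
  obtain ⟨s, hs, hsX, hr⟩ := mem_reach.1 hv
  induction hr with
  | refl =>
    by_contra hR
    exact hsX (h (mem_outBd.2 ⟨by simp, hR, .inl hs⟩))
  | tail hr hE ih =>
    by_contra hR
    exact hE.2 (h (mem_outBd.2 ⟨by simp, hR, .inr ⟨_, ih (mem_reach.2 ⟨s, hs, hsX, hr⟩), hE.1⟩⟩))

lemma isSep_of_outBd_subset {A B X R : Finset V} (h : outBd E A ∅ R ⊆ X) (hB : Disjoint R B) :
    IsSep E A B X :=
  disjoint_reach_iff.1 (hB.mono_left (reach_subset_of_outBd_subset h))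

lemma reach_subset_reach {A X Y : Finset V} (h : Disjoint (reach E A X) Y) :
    reach E A X ⊆ reach E A Y := by
  intro v hv
  obtain ⟨s, hs, hsX, hr⟩ := mem_reach.1 hv
  rw [mem_reach]
  induction hr with
  | refl => exact ⟨s, hs, Finset.disjoint_left.1 h hv, .refl⟩
  | tail hr hE ih =>
    obtain ⟨t, ht, htY, hr'⟩ := ih (mem_reach.2 ⟨s, hs, hsX, hr⟩)
    exact ⟨t, ht, htY, hr'.tail ⟨hE.1, Finset.disjoint_left.1 h hv⟩⟩

lemma reach_mono {A A' X : Finset V} (h : A' ⊆ A) : reach E A' X ⊆ reach E A X := by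
  intro v hv
  obtain ⟨s, hs, hr⟩ := mem_reach.1 hv
  exact mem_reach.2 ⟨s, h hs, hr⟩

lemma rset_ssubset_iff {A X Y : Finset V} :
    RSet E A X ⊂ RSet E A Y ↔ reach E A X ⊂ reach E A Y := by
  rw [← Finset.coe_ssubset]
  simp [reach]

variable [DecidableEq V]

lemma card_outBd_submodular {A A' D R₁ R₂ : Finset V} (h : A' ⊆ A) :
    (outBd E A D (R₁ ∪ R₂)).card + (outBd E A' D (R₁ ∩ R₂)).card ≤
      (outBd E A D R₁).card + (outBd E A' D R₂).card := by
  rw [← Finset.card_union_add_card_inter, ← Finset.card_union_add_card_inter (outBd E A D R₁)]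
  refine add_le_add (Finset.card_le_card ?_) (Finset.card_le_card ?_)
  · intro v
    have := @h v
    simp only [Finset.mem_union, mem_outBd, Finset.mem_inter]
    grind
  · intro v
    have := @h v
    simp only [Finset.mem_union, mem_outBd, Finset.mem_inter]
    grind

lemma IsMinSep.outBd_reach {A B X : Finset V} (h : IsMinSep E A B X) :
    outBd E A ∅ (reach E A X) = X := by
  refine outBd_reach_subset.antisymm fun x hx => ?_
  by_contra hx'
  refine h.2 x hx (isSep_of_outBd_subset (fun v hv => ?_) (disjoint_reach_iff.2 h.1))
  exact Finset.mem_erase.2 ⟨fun e => hx' (e ▸ hv), outBd_reach_subset hv⟩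

lemma isImpSep_iff {A B X : Finset V} :
    IsImpSep E A B X ↔ outBd E A ∅ (reach E A X) = X ∧ Disjoint (reach E A X) B ∧
      ∀ R, reach E A X ⊆ R → Disjoint R B → X.card ≤ (outBd E A ∅ R).card ∧
        (¬ Disjoint R X → X.card < (outBd E A ∅ R).card) := by
  constructor
  · rintro ⟨hmin, himp⟩
    refine ⟨hmin.outBd_reach, disjoint_reach_iff.2 hmin.1, fun R hR hB => ?_⟩
    have key : (outBd E A ∅ R).card ≤ X.card → outBd E A ∅ R = X := by
      intro hc
      have hsub : reach E A X ⊆ reach E A (outBd E A ∅ R) :=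
        reach_subset_reach (disjoint_outBd.mono_left hR)
      have heq : reach E A X = reach E A (outBd E A ∅ R) := by
        by_contra hne
        exact himp ⟨_, isSep_of_outBd_subset subset_rfl hB, hc,
          rset_ssubset_iff.2 (hsub.ssubset_of_ne hne)⟩
      refine (Finset.eq_of_subset_of_card_le ?_ hc).symm
      conv_lhs => rw [← hmin.outBd_reach, heq]
      exact outBd_reach_subset
    constructor
    · by_contra! hc
      exact hc.ne (congrArg Finset.card (key hc.le))
    · intro hd
      by_contra! hc
      exact hd (key hc ▸ disjoint_outBd)
  · rintro ⟨hbd, hB, hR⟩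
    refine ⟨⟨disjoint_reach_iff.1 hB, fun x hx hs => ?_⟩, ?_⟩
    · have h1 := (hR (reach E A (X.erase x))
        (reach_subset_reach (disjoint_reach_self.mono_right (Finset.erase_subset _ _)))
        (disjoint_reach_iff.2 hs)).1
      have h2 := Finset.card_le_card (outBd_reach_subset (E := E) (A := A) (X := X.erase x))
      have h3 := Finset.card_erase_lt_of_mem hx
      omega
    · rintro ⟨Y, hs, hc, hlt⟩
      rw [rset_ssubset_iff] at hlt
      have h1 := (hR _ hlt.1 (disjoint_reach_iff.2 hs)).2
      have h2 := Finset.card_le_card (outBd_reach_subset (E := E) (A := A) (X := Y))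
      by_cases hd : Disjoint (reach E A Y) X
      · exact hlt.2 (reach_subset_reach hd)
      · have := h1 hd
        omega

/-- Importance of a separator is witnessed by few sources. -/
lemma IsImpSep.exists_subset_source {A B X : Finset V} (h : IsImpSep E A B X) :
    ∃ A' ⊆ A, A'.card ≤ X.card ∧ IsImpSep E A' B X := by
  obtain ⟨hbd, hB, hR⟩ := isImpSep_iff.1 h
  have hex : ∀ x ∈ X, ∃ a ∈ A, x ∈ outBd E {a} ∅ (reach E {a} X) := by
    intro x hx
    have hnr : ∀ a, x ∉ reach E {a} X := fun a => Finset.disjoint_right.1 disjoint_reach_self hx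
    rw [← hbd] at hx
    rcases (mem_outBd.1 hx).2.2 with hA | ⟨u, hu, hE⟩
    · exact ⟨x, hA, mem_outBd.2 ⟨by simp, hnr x, .inl (by simp)⟩⟩
    · obtain ⟨a, ha, hr⟩ := mem_reach.1 hu
      exact ⟨a, ha, mem_outBd.2
        ⟨by simp, hnr a, .inr ⟨u, mem_reach.2 ⟨a, by simp, hr⟩, hE⟩⟩⟩
  choose! f hfA hf using hex
  have hsub : X.image f ⊆ A := Finset.image_subset_iff.2 hfA
  have hX : ∀ R, reach E (X.image f) X ⊆ R → Disjoint R X → X ⊆ outBd E (X.image f) ∅ R := by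
    intro R hR' hd x hx
    refine mem_outBd.2 ⟨by simp, Finset.disjoint_right.1 hd hx, ?_⟩
    have hfx : f x ∈ X.image f := Finset.mem_image_of_mem f hx
    rcases (mem_outBd.1 (hf x hx)).2.2 with h1 | ⟨u, hu, hE⟩
    · rw [Finset.mem_singleton] at h1
      exact .inl (h1 ▸ hfx)
    · exact .inr ⟨u, hR' (reach_mono (Finset.singleton_subset_iff.2 hfx) hu), hE⟩
  refine ⟨X.image f, hsub, Finset.card_image_le, isImpSep_iff.2
    ⟨outBd_reach_subset.antisymm (hX _ subset_rfl disjoint_reach_self),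
      hB.mono_left (reach_mono hsub), fun R hR' hRB => ?_⟩⟩
  have h1 := card_outBd_submodular (E := E) (D := ∅) (R₁ := reach E A X) (R₂ := R) hsub
  have h2 := Finset.card_le_card (hX (reach E A X ∩ R)
    (Finset.subset_inter (reach_mono hsub) hR')
    (disjoint_reach_self.mono_left Finset.inter_subset_left))
  obtain ⟨h3, h4⟩ := hR (reach E A X ∪ R) Finset.subset_union_left
    (Finset.disjoint_union_left.2 ⟨hB, hRB⟩)
  rw [hbd] at h1
  refine ⟨by omega, fun hd => ?_⟩
  have := h4 fun hd' => hd (hd'.mono_left Finset.subset_union_right)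
  omega

/-- Raising the smallest boundary size of the sets avoiding `B₀` by one costs one vertex. -/
lemma exists_augment {A B B₀ L : Finset V} {m : ℕ}
    (h0 : ∀ R, L ⊆ R → Disjoint R B₀ → m ≤ (outBd E A ∅ R).card)
    (h1 : ∀ R, L ⊆ R → Disjoint R B → m + 1 ≤ (outBd E A ∅ R).card) :
    ∃ B₁ ⊆ B, B₁.card ≤ 1 ∧
      ∀ R, L ⊆ R → Disjoint R (B₀ ∪ B₁) → m + 1 ≤ (outBd E A ∅ R).card := by
  by_cases hex : ∃ R, L ⊆ R ∧ Disjoint R B₀ ∧ (outBd E A ∅ R).card ≤ m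
  · obtain ⟨Q, hQ⟩ := exists_minimal_of_wellFoundedLT _ hex
    obtain ⟨⟨hLQ, hQB, hQm⟩, hmin⟩ := hQ
    have hnd : ¬ Disjoint Q B := fun hd => by
      have := h1 Q hLQ hd
      omega
    obtain ⟨b, hbQ, hbB⟩ := Finset.not_disjoint_iff.1 hnd
    refine ⟨{b}, by simpa using hbB, by simp, fun R hLR hd => ?_⟩
    rw [Finset.disjoint_union_right] at hd
    by_contra! hc
    have hs := card_outBd_submodular (E := E) (D := ∅) (R₁ := Q) (R₂ := R) (subset_refl A)
    have hu := h0 (Q ∪ R) (hLQ.trans Finset.subset_union_left)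
      (Finset.disjoint_union_left.2 ⟨hQB, hd.1⟩)
    have hsub := hmin ⟨Finset.subset_inter hLQ hLR, hQB.mono_left Finset.inter_subset_left,
      by omega⟩ Finset.inter_subset_left
    exact Finset.disjoint_right.1 hd.2 (Finset.mem_singleton_self b)
      (Finset.mem_inter.1 (hsub hbQ)).2
  · push Not at hex
    exact ⟨∅, by simp, by simp, fun R hL hd => hex R hL (by simpa using hd)⟩

lemma exists_card_le_of_le_card_outBd {A B L : Finset V} (n : ℕ)
    (h : ∀ R, L ⊆ R → Disjoint R B → n ≤ (outBd E A ∅ R).card) :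
    ∃ B₀ ⊆ B, B₀.card ≤ n ∧ ∀ R, L ⊆ R → Disjoint R B₀ → n ≤ (outBd E A ∅ R).card := by
  induction n with
  | zero => exact ⟨∅, by simp⟩
  | succ n ih =>
    obtain ⟨B₀, hB₀, hc₀, h₀⟩ := ih fun R hL hd => (Nat.le_succ n).trans (h R hL hd)
    obtain ⟨B₁, hB₁, hc₁, h₁⟩ := exists_augment h₀ h
    exact ⟨B₀ ∪ B₁, Finset.union_subset hB₀ hB₁,
      (Finset.card_union_le _ _).trans (by omega), h₁⟩

/-- Importance of a separator is witnessed by few sinks. -/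
lemma IsImpSep.exists_subset_sink {A B X : Finset V} (h : IsImpSep E A B X) :
    ∃ B' ⊆ B, B'.card ≤ 2 * X.card ∧ IsImpSep E A B' X := by
  obtain ⟨hbd, hB, hR⟩ := isImpSep_iff.1 h
  obtain ⟨B₀, hB₀, hc₀, h₀⟩ :=
    exists_card_le_of_le_card_outBd X.card fun R hL hd => (hR R hL hd).1
  have hex : ∀ x ∈ X, ∃ B₁ ⊆ B, B₁.card ≤ 1 ∧ ∀ R, insert x (reach E A X) ⊆ R →
      Disjoint R (B₀ ∪ B₁) → X.card + 1 ≤ (outBd E A ∅ R).card := by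
    intro x hx
    refine exists_augment (fun R hL hd => h₀ R ((Finset.subset_insert _ _).trans hL) hd)
      fun R hL hd => (hR R ((Finset.subset_insert _ _).trans hL) hd).2 ?_
    exact Finset.not_disjoint_iff.2 ⟨x, hL (Finset.mem_insert_self _ _), hx⟩
  choose! f hfB hfc hf using hex
  have hsub : B₀ ∪ X.biUnion f ⊆ B :=
    Finset.union_subset hB₀ (Finset.biUnion_subset.2 hfB)
  refine ⟨B₀ ∪ X.biUnion f, hsub, ?_, isImpSep_iff.2
    ⟨hbd, hB.mono_right hsub, fun R hL hd => ⟨h₀ R hL (hd.mono_right Finset.subset_union_left),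
      fun hRX => ?_⟩⟩⟩
  · have h1 := Finset.card_union_le B₀ (X.biUnion f)
    have h2 := Finset.card_biUnion_le_card_mul X f 1 hfc
    omega
  · obtain ⟨x, hxR, hx⟩ := Finset.not_disjoint_iff.1 hRX
    exact hf x hx R (Finset.insert_subset hxR hL)
      (hd.mono_right (Finset.union_subset_union_right (Finset.subset_biUnion_of_mem f hx)))

/-- Sets containing `L` and avoiding `B` that have boundary size at most `k`, an
inclusion-minimal boundary, and no proper superset with a boundary at most as large. -/
def IsImpSet (E : V → V → Prop) (A D L B : Finset V) (k : ℕ) (R : Finset V) : Prop :=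
  L ⊆ R ∧ Disjoint R B ∧ (outBd E A D R).card ≤ k ∧
    (∀ Q, L ⊆ Q → Disjoint Q B → ¬ outBd E A D Q ⊂ outBd E A D R) ∧
    ∀ Q, R ⊆ Q → Disjoint Q B → (outBd E A D Q).card ≤ (outBd E A D R).card → Q ⊆ R

lemma ncard_isImpSet_le_one {A D L B Q : Finset V} {k : ℕ} (hLQ : L ⊆ Q) (hQB : Disjoint Q B)
    (hQ : outBd E A D Q = ∅) : {R | IsImpSet E A D L B k R}.ncard ≤ 1 := by
  rw [Set.ncard_le_one]
  have hemp : ∀ R, IsImpSet E A D L B k R → outBd E A D R = ∅ := fun R hR => by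
    by_contra hne
    exact hR.2.2.2.1 Q hLQ hQB (hQ ▸ Finset.empty_ssubset.2 (Finset.nonempty_iff_ne_empty.2 hne))
  have hle : ∀ R R', IsImpSet E A D L B k R → IsImpSet E A D L B k R' → R' ⊆ R := by
    intro R R' hR hR'
    have hs := card_outBd_submodular (E := E) (D := D) (R₁ := R) (R₂ := R') (subset_refl A)
    rw [hemp R hR, hemp R' hR', Finset.card_empty] at hs
    exact Finset.subset_union_right.trans (hR.2.2.2.2 (R ∪ R') Finset.subset_union_left
      (Finset.disjoint_union_left.2 ⟨hR.2.1, hR'.2.1⟩) (by omega))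
  exact fun R hR R' hR' => (hle R' R hR' hR).antisymm (hle R R' hR hR')

lemma ncard_isImpSet_le {A : Finset V} (n : ℕ) : ∀ (D L B : Finset V) (k m : ℕ),
    (∀ R, L ⊆ R → Disjoint R B → m ≤ (outBd E A D R).card) → 2 * k ≤ m + n →
    {R | IsImpSet E A D L B k R}.ncard ≤ 2 ^ n := by
  induction n with
  | zero =>
    intro D L B k m hm hk
    rcases Set.eq_empty_or_nonempty {R | IsImpSet E A D L B k R} with he | ⟨R, hR⟩
    · simp [he]
    · have h1 := hm R hR.1 hR.2.1
      have h2 := hR.2.2.1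
      exact ncard_isImpSet_le_one hR.1 hR.2.1 (Finset.card_eq_zero.1 (by omega))
  | succ n ih =>
    intro D L B k m hm hk
    rcases Set.eq_empty_or_nonempty {R | IsImpSet E A D L B k R} with he | ⟨R₀, hR₀⟩
    · simp [he]
    obtain ⟨M, ⟨hLM, hMB⟩, hMmin⟩ :=
      Set.exists_min_image {R | L ⊆ R ∧ Disjoint R B} (fun R => (outBd E A D R).card)
        (Set.toFinite _) ⟨R₀, hR₀.1, hR₀.2.1⟩
    obtain ⟨Q, ⟨hLQ, hQB, hQM⟩, hQmax⟩ := exists_maximal_of_wellFoundedGT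
      (fun R => L ⊆ R ∧ Disjoint R B ∧ (outBd E A D R).card ≤ (outBd E A D M).card)
      ⟨M, hLM, hMB, le_rfl⟩
    have hQmin : ∀ R, L ⊆ R → Disjoint R B → (outBd E A D Q).card ≤ (outBd E A D R).card :=
      fun R hL hd => hQM.trans (hMmin R ⟨hL, hd⟩)
    rcases Finset.eq_empty_or_nonempty (outBd E A D Q) with he | ⟨v, hv⟩
    · exact (ncard_isImpSet_le_one hLQ hQB he).trans Nat.one_le_two_pow
    have hmQ := hm Q hLQ hQB
    have hpos : 0 < (outBd E A D Q).card := Finset.card_pos.2 ⟨v, hv⟩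
    have hQk := (hQmin R₀ hR₀.1 hR₀.2.1).trans hR₀.2.2.1
    have hmem : ∀ R, Q ⊆ R → v ∉ R → v ∈ outBd E A D R := by
      intro R hQR hvR
      obtain ⟨h1, -, h3⟩ := mem_outBd.1 hv
      exact mem_outBd.2 ⟨h1, hvR, h3.imp_right fun ⟨u, hu, h⟩ => ⟨u, hQR hu, h⟩⟩
    have hins : ∀ R, outBd E A (insert v D) R = (outBd E A D R).erase v := by
      intro R
      ext w
      simp only [mem_outBd, Finset.mem_erase, Finset.mem_insert]
      tauto
    have hsub : {R | IsImpSet E A D L B k R} ⊆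
        {R | IsImpSet E A D (insert v Q) B k R} ∪
          {R | IsImpSet E A (insert v D) Q (insert v B) (k - 1) R} := by
      intro R hR
      have hQR : Q ⊆ R := by
        have hs := card_outBd_submodular (E := E) (D := D) (R₁ := R) (R₂ := Q) (subset_refl A)
        have hi := hQmin (R ∩ Q) (Finset.subset_inter hR.1 hLQ)
          (hQB.mono_left Finset.inter_subset_right)
        exact Finset.subset_union_right.trans (hR.2.2.2.2 (R ∪ Q) Finset.subset_union_left
          (Finset.disjoint_union_left.2 ⟨hR.2.1, hQB⟩) (by omega))
      obtain ⟨-, hRB, hRk, hRm, hRi⟩ := hR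
      by_cases hvR : v ∈ R
      · exact .inl ⟨Finset.insert_subset hvR hQR, hRB, hRk, fun P hP => hRm P
          (hLQ.trans ((Finset.subset_insert _ _).trans hP)), hRi⟩
      · have hvb := hmem R hQR hvR
        refine .inr ⟨hQR, Finset.disjoint_insert_right.2 ⟨hvR, hRB⟩, ?_, ?_, ?_⟩
        · rw [hins, Finset.card_erase_of_mem hvb]
          omega
        · intro P hP hd
          rw [Finset.disjoint_insert_right] at hd
          have hvP := hmem P hP hd.1
          rw [hins, hins]
          intro hlt
          refine hRm P (hLQ.trans hP) hd.2 ?_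
          rw [← Finset.insert_erase hvb, ← Finset.insert_erase hvP]
          refine (Finset.insert_subset_insert v hlt.1).ssubset_of_ne fun he => hlt.ne ?_
          rw [← Finset.erase_insert (Finset.notMem_erase v (outBd E A D P)), he,
            Finset.erase_insert (Finset.notMem_erase v _)]
        · intro P hP hd hc
          rw [Finset.disjoint_insert_right] at hd
          rw [hins, hins, Finset.card_erase_of_mem hvb,
            Finset.card_erase_of_mem (hmem P (hQR.trans hP) hd.1)] at hc
          have hRpos : 0 < (outBd E A D R).card := Finset.card_pos.2 ⟨v, hvb⟩
          exact hRi P hP hd.2 (by omega)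
    have h1 : {R | IsImpSet E A D (insert v Q) B k R}.ncard ≤ 2 ^ n := by
      refine ih D (insert v Q) B k ((outBd E A D Q).card + 1) (fun R hL hd => ?_) (by omega)
      have hQR := (Finset.subset_insert v Q).trans hL
      by_contra! hc
      have := hQmax ⟨hLQ.trans hQR, hd, by omega⟩ hQR
      exact (mem_outBd.1 hv).2.1 (this (hL (Finset.mem_insert_self v Q)))
    have h2 : {R | IsImpSet E A (insert v D) Q (insert v B) (k - 1) R}.ncard ≤ 2 ^ n := by
      refine ih _ Q _ (k - 1) ((outBd E A D Q).card - 1) (fun R hL hd => ?_) (by omega)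
      rw [Finset.disjoint_insert_right] at hd
      rw [hins, Finset.card_erase_of_mem (hmem R hL hd.1)]
      have := hQmin R (hLQ.trans hL) hd.2
      omega
    calc _ ≤ _ := Set.ncard_le_ncard hsub (Set.toFinite _)
      _ ≤ _ := Set.ncard_union_le _ _
      _ ≤ 2 ^ n + 2 ^ n := add_le_add h1 h2
      _ = 2 ^ (n + 1) := by ring

lemma IsImpSep.exists_isImpSet {A B X : Finset V} {k : ℕ} (h : IsImpSep E A B X)
    (hk : X.card ≤ k) : ∃ R, IsImpSet E A ∅ ∅ B k R ∧ outBd E A ∅ R = X := by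
  obtain ⟨hbd, hB, hR⟩ := isImpSep_iff.1 h
  obtain ⟨Q, ⟨hLQ, hQB, hQX⟩, hQmax⟩ := exists_maximal_of_wellFoundedGT
    (fun R => reach E A X ⊆ R ∧ Disjoint R B ∧ (outBd E A ∅ R).card ≤ X.card)
    ⟨_, subset_rfl, hB, hbd.symm ▸ le_rfl⟩
  have hd : Disjoint Q X := by
    by_contra hd
    have := (hR Q hLQ hQB).2 hd
    omega
  have hQ : outBd E A ∅ Q = X := by
    refine (Finset.eq_of_subset_of_card_le (fun x hx => ?_) hQX).symm
    have hxQ := Finset.disjoint_right.1 hd hx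
    rw [← hbd] at hx
    exact mem_outBd.2 ⟨by simp, hxQ, (mem_outBd.1 hx).2.2.imp_right
      fun ⟨u, hu, hE⟩ => ⟨u, hLQ hu, hE⟩⟩
  refine ⟨Q, ⟨by simp, hQB, by rwa [hQ], fun P _ hPB hlt => ?_, fun P hQP hPB hc => ?_⟩, hQ⟩
  · rw [hQ] at hlt
    obtain ⟨x, hx, hxP⟩ := Finset.exists_of_ssubset hlt
    exact h.1.2 x hx (isSep_of_outBd_subset
      (fun y hy => Finset.mem_erase.2 ⟨fun e => hxP (e ▸ hy), hlt.1 hy⟩) hPB)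
  · exact hQmax ⟨hLQ.trans hQP, hPB, hQ ▸ hc⟩ hQP

/-- There are at most `2 ^ (2 * k - 1)` nonempty important `A`-`B` separators of size at
most `k`. -/
lemma ncard_nonempty_isImpSep_le (E : V → V → Prop) (A B : Finset V) (k : ℕ) :
    {X : Finset V | X.Nonempty ∧ X.card ≤ k ∧ IsImpSep E A B X}.ncard ≤ 2 ^ (2 * k - 1) := by
  rcases Set.eq_empty_or_nonempty {X : Finset V | X.Nonempty ∧ X.card ≤ k ∧ IsImpSep E A B X}
    with he | ⟨X, ⟨x, hx⟩, -, hX⟩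
  · simp [he]
  calc _ ≤ (outBd E A ∅ '' {R | IsImpSet E A ∅ ∅ B k R}).ncard :=
        Set.ncard_le_ncard (fun Y hY => hY.2.2.exists_isImpSet hY.2.1) (Set.toFinite _)
    _ ≤ _ := Set.ncard_image_le (Set.toFinite _)
    _ ≤ _ := ncard_isImpSet_le (2 * k - 1) ∅ ∅ B k 1 (fun R _ hd => ?_) (by omega)
  rw [Nat.one_le_iff_ne_zero, Ne, Finset.card_eq_zero]
  intro he
  exact hX.1.2 x hx (isSep_of_outBd_subset (he.trans_subset (Finset.empty_subset _)) hd)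

end

lemma IsMinSep.source_nonempty {V : Type*} [DecidableEq V] {E : V → V → Prop}
    {A B X : Finset V} (h : IsMinSep E A B X) (hX : X.Nonempty) : A.Nonempty := by
  obtain ⟨x, hx⟩ := hX
  rw [Finset.nonempty_iff_ne_empty]
  rintro rfl
  exact h.2 x hx fun b _ hb => by simp [RSet] at hb

lemma IsMinSep.sink_nonempty {V : Type*} [DecidableEq V] {E : V → V → Prop}
    {A B X : Finset V} (h : IsMinSep E A B X) (hX : X.Nonempty) : B.Nonempty := by
  obtain ⟨x, hx⟩ := hX
  rw [Finset.nonempty_iff_ne_empty]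
  rintro rfl
  exact h.2 x hx (by simp [IsSep])

lemma card_biUnion_powersetCard {V : Type*} [DecidableEq V] (S : Finset V) (c : ℕ) :
    ((Finset.Icc 1 c).biUnion fun i => S.powersetCard i).card = prefBinom S.card c := by
  rw [Finset.card_biUnion fun i _ j _ hij => Finset.pairwise_disjoint_powersetCard S hij]
  simp [prefBinom]

lemma prefBinom_pos {x c : ℕ} (hx : 0 < x) (hc : 0 < c) : 0 < prefBinom x c :=
  Finset.sum_pos' (by simp) ⟨1, by simp; omega, by simpa using hx⟩

/-- the number of sets `X ⊆ V(G)` that are an important `A`-`B` separator of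
size at most `k` for some `A ⊆ S`, `B ⊆ T` is at most `4^k · C(|S|,≤k) · C(|T|,≤2k)`. -/
theorem all_subsets_important_separators
    (V : Type*) [Fintype V] [DecidableEq V] (E : V → V → Prop)
    (k : ℕ) (hk : 0 < k) (S T : Finset V) (hST : Disjoint S T)
    (hS : S.Nonempty) (hT : T.Nonempty) :
    {X : Finset V | X.card ≤ k ∧ ∃ A ⊆ S, ∃ B ⊆ T, IsImpSep E A B X}.ncard ≤
      4 ^ k * prefBinom S.card k * prefBinom T.card (2 * k) := by
  set P := ((Finset.Icc 1 k).biUnion fun i => S.powersetCard i) ×ˢ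
    ((Finset.Icc 1 (2 * k)).biUnion fun i => T.powersetCard i) with hP
  have hPcard : P.card = prefBinom S.card k * prefBinom T.card (2 * k) := by
    rw [hP, Finset.card_product, card_biUnion_powersetCard, card_biUnion_powersetCard]
  have hPpos : 0 < P.card := hPcard ▸ Nat.mul_pos (prefBinom_pos hS.card_pos hk)
    (prefBinom_pos hT.card_pos (by omega))
  have hsub : {X : Finset V | X.card ≤ k ∧ ∃ A ⊆ S, ∃ B ⊆ T, IsImpSep E A B X} ⊆
      {∅} ∪ ⋃ p ∈ P, {X : Finset V | X.Nonempty ∧ X.card ≤ k ∧ IsImpSep E p.1 p.2 X} := by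
    rintro X ⟨hXk, A, hA, B, hB, h⟩
    rcases X.eq_empty_or_nonempty with rfl | hX
    · exact .inl rfl
    obtain ⟨A', hA', hAc, h'⟩ := h.exists_subset_source
    obtain ⟨B', hB', hBc, h''⟩ := h'.exists_subset_sink
    have hA1 := (h''.1.source_nonempty hX).card_pos
    have hB1 := (h''.1.sink_nonempty hX).card_pos
    refine .inr (Set.mem_iUnion₂.2 ⟨(A', B'), ?_, hX, hXk, h''⟩)
    simp only [hP, Finset.mem_product, Finset.mem_biUnion, Finset.mem_Icc,
      Finset.mem_powersetCard]
    exact ⟨⟨_, ⟨hA1, by omega⟩, hA'.trans hA, rfl⟩, ⟨_, ⟨hB1, by omega⟩, hB'.trans hB, rfl⟩⟩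
  have hunion : (⋃ p ∈ P, {X : Finset V |
      X.Nonempty ∧ X.card ≤ k ∧ IsImpSep E p.1 p.2 X}).ncard ≤ P.card * 2 ^ (2 * k - 1) := by
    refine (Finset.set_ncard_biUnion_le _ _).trans ?_
    rw [← smul_eq_mul]
    exact Finset.sum_le_card_nsmul _ _ _ fun p _ => ncard_nonempty_isImpSep_le E p.1 p.2 k
  have hpow : 4 ^ k = 2 * 2 ^ (2 * k - 1) := by
    rw [← pow_succ', show 2 * k - 1 + 1 = 2 * k by omega, pow_mul]
    norm_num
  have hone : 0 < P.card * 2 ^ (2 * k - 1) := by positivity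
  calc _ ≤ _ := Set.ncard_le_ncard hsub (Set.toFinite _)
    _ ≤ _ := Set.ncard_union_le _ _
    _ ≤ 1 + P.card * 2 ^ (2 * k - 1) := add_le_add (Set.ncard_singleton _).le hunion
    _ ≤ 2 * 2 ^ (2 * k - 1) * P.card := by linarith
    _ = _ := by rw [hPcard, ← hpow, mul_assoc]
end

section
/- Let G be a digraph, let k be a positive integer, let A, B ⊆ V(G) be disjoint, and let X be an important A-B separator with |X| ≤ k. Then there exist sets A* ⊆ A with |A*| ≤ k and B* ⊆ B with |B*| ≤ 2k such that X is an important A*-B* separator. -/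
open Classical in
/-- The vertices outside `R` that lie in `X` or receive an arc from `R`. -/
noncomputable def sourceCut {V : Type*} [Fintype V] (E : V → V → Prop) (X R : Finset V) :
    Finset V :=
  {v | v ∉ R ∧ (v ∈ X ∨ ∃ u ∈ R, E u v)}

section Reachability

variable {V : Type*} {E : V → V → Prop} {S T X Y : Finset V}

theorem mem_RSet_of_mem {s : V} (hs : s ∈ S) (hX : s ∉ X) : s ∈ RSet E S X :=
  ⟨s, hs, hX, .refl⟩

theorem mem_RSet_of_arc {u v : V} (hu : u ∈ RSet E S X) (huv : E u v) (hv : v ∉ X) :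
    v ∈ RSet E S X := by
  obtain ⟨s, hs, hsX, h⟩ := hu
  exact ⟨s, hs, hsX, h.tail ⟨huv, hv⟩⟩

theorem RSet_subset_of_closed {P : Set V} (h0 : ∀ s ∈ S, s ∉ X → s ∈ P)
    (h1 : ∀ u ∈ P, ∀ v, E u v → v ∉ X → v ∈ P) : RSet E S X ⊆ P := by
  rintro v ⟨s, hs, hsX, h⟩
  induction h with
  | refl => exact h0 s hs hsX
  | tail _ h ih => exact h1 _ ih _ h.1 h.2

theorem not_mem_of_mem_RSet {v : V} (hv : v ∈ RSet E S X) : v ∉ X :=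
  RSet_subset_of_closed (P := {v | v ∉ X}) (fun _ _ h => h) (fun _ _ _ _ h => h) hv

theorem RSet_mono_left (h : S ⊆ T) : RSet E S X ⊆ RSet E T X := by
  rintro v ⟨s, hs, hv⟩
  exact ⟨s, h hs, hv⟩

theorem RSet_subset_RSet_of_disjoint (h : ∀ v ∈ RSet E S X, v ∉ Y) :
    RSet E S X ⊆ RSet E S Y := by
  have hsub : RSet E S X ⊆ RSet E S X ∩ RSet E S Y := by
    refine RSet_subset_of_closed (fun s hs hsX => ?_) ?_
    · have := mem_RSet_of_mem (E := E) hs hsX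
      exact ⟨this, mem_RSet_of_mem hs (h _ this)⟩
    · rintro u ⟨hu, hu'⟩ v huv hv
      have := mem_RSet_of_arc hu huv hv
      exact ⟨this, mem_RSet_of_arc hu' huv (h _ this)⟩
  exact fun v hv => (hsub hv).2

/-- Every vertex of a minimal separator is hit first from some source vertex. -/
theorem IsMinSep.exists_source [DecidableEq V] {A B : Finset V} (hX : IsMinSep E A B X)
    {x : V} (hx : x ∈ X) :
    ∃ a ∈ A, x = a ∨ ∃ u ∈ RSet E {a} X, E u x := by
  by_contra! hcon
  refine hX.2 x hx fun b hb hbR => hX.1 b hb ?_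
  refine RSet_subset_of_closed (P := RSet E A X) (fun s hs hsX => ?_) ?_ hbR
  · refine mem_RSet_of_mem hs fun hs' => hsX (Finset.mem_erase.2 ⟨?_, hs'⟩)
    exact fun h => (hcon s hs).1 h.symm
  · rintro u hu v huv hv
    refine mem_RSet_of_arc hu huv fun hv' => hv (Finset.mem_erase.2 ⟨?_, hv'⟩)
    rintro rfl
    obtain ⟨a, ha, haX, h⟩ := hu
    exact (hcon a ha).2 u ⟨a, Finset.mem_singleton_self a, haX, h⟩ huv

end Reachability

section Cuts

variable {V : Type*} [Fintype V] {E : V → V → Prop} {X : Finset V}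

theorem mem_sourceCut {R : Finset V} {v : V} :
    v ∈ sourceCut E X R ↔ v ∉ R ∧ (v ∈ X ∨ ∃ u ∈ R, E u v) := by
  simp [sourceCut]

variable [DecidableEq V]

theorem card_sourceCut_inter_add_card_sourceCut_union (R T : Finset V) :
    (sourceCut E X (R ∩ T)).card + (sourceCut E X (R ∪ T)).card ≤
      (sourceCut E X R).card + (sourceCut E X T).card := by
  rw [← Finset.card_union_add_card_inter, ← Finset.card_union_add_card_inter (sourceCut E X R)]
  refine Nat.add_le_add (Finset.card_le_card fun v hv => ?_)
    (Finset.card_le_card fun v hv => ?_)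
  · simp only [Finset.mem_union, Finset.mem_inter, mem_sourceCut] at hv ⊢
    grind
  · simp only [Finset.mem_union, Finset.mem_inter, mem_sourceCut] at hv ⊢
    grind

/-- If `S` cannot be cut off with fewer than `m` vertices, and each vertex of `B` can be cut off
together with `S` by `m` vertices while keeping `Z` on the source side, then all of `B` can be
cut off simultaneously in this way. -/
theorem exists_sourceCut_of_forall_insert {S Z B : Finset V} {m : ℕ}
    (hm : ∀ R, Disjoint R S → m ≤ (sourceCut E X R).card)
    (h0 : ∃ R, Disjoint R S ∧ Z ⊆ R ∧ (sourceCut E X R).card ≤ m)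
    (hB : ∀ b ∈ B, ∃ R, Disjoint R (insert b S) ∧ Z ⊆ R ∧ (sourceCut E X R).card ≤ m) :
    ∃ R, Disjoint R B ∧ Z ⊆ R ∧ (sourceCut E X R).card ≤ m := by
  obtain ⟨R, ⟨hRS, hZ, hRm⟩, hmin⟩ := wellFounded_lt.has_min
    {R : Finset V | Disjoint R S ∧ Z ⊆ R ∧ (sourceCut E X R).card ≤ m} h0
  refine ⟨R, Finset.disjoint_left.2 fun b hbR hb => ?_, hZ, hRm⟩
  obtain ⟨T, hTS, hZT, hTm⟩ := hB b hb
  rw [Finset.disjoint_insert_right] at hTS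
  refine hmin (R ∩ T) ⟨hRS.mono_left Finset.inter_subset_left,
    Finset.subset_inter hZ hZT, ?_⟩ ?_
  · have h1 := card_sourceCut_inter_add_card_sourceCut_union (E := E) (X := X) R T
    have h2 := hm (R ∪ T) (Finset.disjoint_union_left.2 ⟨hRS, hTS.2⟩)
    omega
  · refine Finset.ssubset_iff_subset_ne.2 ⟨Finset.inter_subset_left, fun h => hTS.1 ?_⟩
    exact (Finset.mem_inter.1 (h ▸ hbR)).2

/-- If `B` cannot be cut off with fewer than `n` vertices, this is witnessed by at most `m` of
its vertices, for each `m ≤ n`. -/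
theorem exists_subset_forall_le_card_sourceCut {B : Finset V} {n : ℕ}
    (hB : ∀ R, Disjoint R B → n ≤ (sourceCut E X R).card) (m : ℕ) (hm : m ≤ n) :
    ∃ S ⊆ B, S.card ≤ m ∧ ∀ R, Disjoint R S → m ≤ (sourceCut E X R).card := by
  induction m with
  | zero => exact ⟨∅, by simp, by simp, by simp⟩
  | succ m ih =>
    obtain ⟨S, hSB, hSm, hS⟩ := ih (by omega)
    by_contra! hcon
    obtain ⟨R, hRB, -, hR⟩ := exists_sourceCut_of_forall_insert (Z := ∅) (B := B) hS
      (by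
        obtain ⟨R, hR, hc⟩ := hcon S hSB (by omega)
        exact ⟨R, hR, by simp, by omega⟩)
      (by
        intro b hb
        obtain ⟨R, hR, hc⟩ := hcon (insert b S) (Finset.insert_subset hb hSB)
          ((Finset.card_insert_le _ _).trans (by omega))
        exact ⟨R, hR, by simp, by omega⟩)
    have := hB R hRB
    omega

/-- If `X` is the unique smallest vertex cut between `X` and `B`, then this is witnessed by at
most `2 * X.card` vertices of `B`. -/
theorem exists_subset_forall_card_lt_card_sourceCut {B : Finset V}
    (hB : ∀ R, Disjoint R B → ∀ x ∈ X, x ∈ R → X.card < (sourceCut E X R).card) :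
    ∃ S ⊆ B, S.card ≤ 2 * X.card ∧
      ∀ R, Disjoint R S → ∀ x ∈ X, x ∈ R → X.card < (sourceCut E X R).card := by
  obtain ⟨S, hSB, hSc, hS⟩ := exists_subset_forall_le_card_sourceCut (E := E) (X := X) (B := B)
    (n := X.card) (by
      intro R hR
      by_cases h : ∃ x ∈ X, x ∈ R
      · obtain ⟨x, hx, hxR⟩ := h
        exact (hB R hR x hx hxR).le
      · push Not at h
        exact Finset.card_le_card fun x hx => mem_sourceCut.2 ⟨h x hx, .inl hx⟩) X.card le_rfl
  have key : ∀ x ∈ X, ∃ D ⊆ B, D.card ≤ 1 ∧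
      ∀ R, Disjoint R (D ∪ S) → x ∈ R → X.card < (sourceCut E X R).card := by
    intro x hx
    by_contra! hcon
    obtain ⟨R, hRB, hxR, hR⟩ := exists_sourceCut_of_forall_insert (Z := {x}) (B := B) hS
      (by simpa using hcon ∅ (by simp) (by simp))
      (by
        intro b hb
        simpa using hcon {b} (by simpa using hb) (by simp))
    have := hB R hRB x hx (by simpa using hxR)
    omega
  choose! D hDB hDc hD using key
  refine ⟨X.biUnion D ∪ S, Finset.union_subset (Finset.biUnion_subset.2 hDB) hSB, ?_, ?_⟩
  · have h1 := Finset.card_union_le (X.biUnion D) S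
    have h2 := Finset.card_biUnion_le_card_mul X D 1 hDc
    omega
  · intro R hR x hx hxR
    refine hD x hx R (hR.mono_right ?_) hxR
    exact Finset.union_subset_union_left (Finset.subset_biUnion_of_mem D hx)

theorem IsImpSep.card_lt_card_sourceCut {A B : Finset V} (hX : IsImpSep E A B X)
    (R : Finset V) (hR : Disjoint R B) (x : V) (hx : x ∈ X) (hxR : x ∈ R) :
    X.card < (sourceCut E X R).card := by
  classical
  by_contra! hc
  let Y : Finset V := {v ∈ sourceCut E X R | v ∉ RSet E A X}
  have hmem : ∀ v, v ∉ Y → (v ∈ X ∨ ∃ u ∈ R, E u v) → v ∈ (R : Set V) ∪ RSet E A X := by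
    intro v hv h
    by_contra! hv'
    simp only [Set.mem_union, Finset.mem_coe, not_or] at hv'
    exact hv (Finset.mem_filter.2 ⟨mem_sourceCut.2 ⟨hv'.1, h⟩, hv'.2⟩)
  have hsub : RSet E A X ⊆ RSet E A Y :=
    RSet_subset_RSet_of_disjoint fun v hv hvY => (Finset.mem_filter.1 hvY).2 hv
  refine hX.2 ⟨Y, fun b hb hbY => ?_, (Finset.card_filter_le _ _).trans hc, hsub, fun hle => ?_⟩
  · have : b ∈ (R : Set V) ∪ RSet E A X := by
      refine RSet_subset_of_closed (fun s hs hsY => ?_) (fun u hu v huv hv => ?_) hbY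
      · by_cases hsX : s ∈ X
        · exact hmem s hsY (.inl hsX)
        · exact .inr (mem_RSet_of_mem hs hsX)
      · rcases hu with hu | hu
        · exact hmem v hv (.inr ⟨u, hu, huv⟩)
        · by_cases hvX : v ∈ X
          · exact hmem v hv (.inl hvX)
          · exact .inr (mem_RSet_of_arc hu huv hvX)
    rcases this with h | h
    · exact Finset.disjoint_left.1 hR h hb
    · exact hX.1.1 b hb h
  · have hxY : x ∉ Y := fun h => (mem_sourceCut.1 (Finset.mem_filter.1 h).1).1 hxR
    refine not_mem_of_mem_RSet (hle ?_) hx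
    obtain ⟨a, ha, rfl | ⟨u, hu, hux⟩⟩ := hX.1.exists_source hx
    · exact mem_RSet_of_mem ha hxY
    · exact mem_RSet_of_arc (hsub (RSet_mono_left (by simpa using ha) hu)) hux hxY

/-- A separator each of whose vertices is hit first from `A`, and which is the unique smallest
vertex cut between itself and `B`, is important. -/
theorem IsSep.isImpSep {A B : Finset V} (hX : IsSep E A B X)
    (hA : ∀ x ∈ X, x ∈ A ∨ ∃ u ∈ RSet E A X, E u x)
    (hB : ∀ R, Disjoint R B → ∀ x ∈ X, x ∈ R → X.card < (sourceCut E X R).card) :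
    IsImpSep E A B X := by
  classical
  have key : ∀ Y : Finset V, IsSep E A B Y → Y.card ≤ X.card → RSet E A X ⊆ RSet E A Y →
      X = Y := by
    intro Y hY hYc hsub
    let R : Finset V := {v | v ∈ RSet E A Y}
    have hR : ∀ v, v ∈ R ↔ v ∈ RSet E A Y := by simp [R]
    have hcut : sourceCut E X R ⊆ Y := by
      intro v hv
      obtain ⟨hvR, hv⟩ := mem_sourceCut.1 hv
      by_contra hvY
      refine hvR ((hR v).2 ?_)
      rcases hv with hv | ⟨u, hu, huv⟩
      · rcases hA v hv with h | ⟨u, hu, huv⟩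
        · exact mem_RSet_of_mem h hvY
        · exact mem_RSet_of_arc (hsub hu) huv hvY
      · exact mem_RSet_of_arc ((hR u).1 hu) huv hvY
    have hRB : Disjoint R B := Finset.disjoint_left.2 fun b hb hbB => hY b hbB ((hR b).1 hb)
    refine Finset.eq_of_subset_of_card_le (fun x hx => hcut (mem_sourceCut.2 ⟨fun hxR => ?_,
      .inl hx⟩)) hYc
    have h1 := hB R hRB x hx hxR
    have h2 := Finset.card_le_card hcut
    omega
  refine ⟨⟨hX, fun x hx hsep => ?_⟩, ?_⟩
  · have h := key (X.erase x) hsep (Finset.card_le_card (Finset.erase_subset _ _))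
      (RSet_subset_RSet_of_disjoint fun v hv hv' =>
        not_mem_of_mem_RSet hv (Finset.mem_of_mem_erase hv'))
    rw [h] at hx
    exact Finset.notMem_erase x X (h ▸ hx)
  · rintro ⟨Y, hY, hYc, hss⟩
    obtain rfl := key Y hY hYc hss.subset
    exact hss.ne rfl

end Cuts

/-- every important `A`-`B` separator of size at most `k` is also an
important `A*`-`B*` separator for some `A* ⊆ A` with `|A*| ≤ k` and `B* ⊆ B` with
`|B*| ≤ 2k`. -/
theorem important_separator_small_subsets
    (V : Type*) [Fintype V] [DecidableEq V] (E : V → V → Prop)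
    (k : ℕ) (hk : 0 < k) (A B : Finset V) (hAB : Disjoint A B)
    (X : Finset V) (hX : IsImpSep E A B X) (hXk : X.card ≤ k) :
    ∃ Astar ⊆ A, ∃ Bstar ⊆ B,
      Astar.card ≤ k ∧ Bstar.card ≤ 2 * k ∧ IsImpSep E Astar Bstar X := by
  obtain ⟨S, hSB, hSc, hS⟩ := exists_subset_forall_card_lt_card_sourceCut
    hX.card_lt_card_sourceCut
  choose! a haA ha using fun x (hx : x ∈ X) => hX.1.exists_source hx
  have hsub : X.image a ⊆ A := Finset.image_subset_iff.2 haA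
  refine ⟨X.image a, hsub, S, hSB, Finset.card_image_le.trans hXk, by omega, ?_⟩
  refine IsSep.isImpSep (fun b hb hbR => hX.1.1 b (hSB hb) (RSet_mono_left hsub hbR))
    (fun x hx => ?_) hS
  have hax : a x ∈ X.image a := Finset.mem_image_of_mem a hx
  rcases ha x hx with h | ⟨u, hu, hux⟩
  · exact .inl (h ▸ hax)
  · exact .inr ⟨u, RSet_mono_left (by simpa using hax) hu, hux⟩
end

section
/- For every positive integer k there exist infinitely many positive integers c with the following property: there is a digraph G and disjoint sets S, T ⊆ V(G) with |S| = 1 and |T| = c such that the number of distinct sets X ⊆ V(G) that are an important A-B separator of size at most k for some A ⊆ S and some B ⊆ T is at least C(|T|, ≤k). -/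
theorem mem_RSet_star {n : ℕ} {X : Finset (Fin (n + 1))} (hX : 0 ∉ X) (v : Fin (n + 1)) :
    v ∈ RSet (fun a b : Fin (n + 1) => a = 0 ∧ b ≠ 0) {0} X ↔ v ∉ X := by
  constructor
  · rintro ⟨s, -, hsX, h⟩
    cases h with
    | refl => exact hsX
    | tail _ h => exact h.2
  · intro hv
    refine ⟨0, Finset.mem_singleton_self 0, hX, ?_⟩
    by_cases h0 : v = 0
    · rw [h0]
    · exact Relation.ReflTransGen.single ⟨⟨rfl, h0⟩, hv⟩

theorem isSep_star_iff {n : ℕ} {B X : Finset (Fin (n + 1))} (hX : 0 ∉ X) :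
    IsSep (fun a b : Fin (n + 1) => a = 0 ∧ b ≠ 0) {0} B X ↔ B ⊆ X := by
  simp only [IsSep, mem_RSet_star hX, not_not, Finset.subset_iff]

/-- In the out-star centred at `0`, every set `B` of leaves is an important `{0}`-`B` separator. -/
theorem isImpSep_star {n : ℕ} {B : Finset (Fin (n + 1))} (hB : 0 ∉ B) :
    IsImpSep (fun a b : Fin (n + 1) => a = 0 ∧ b ≠ 0) {0} B B := by
  refine ⟨⟨(isSep_star_iff hB).2 subset_rfl, fun v hv hsep => ?_⟩, ?_⟩
  · have h0 : 0 ∉ B.erase v := fun h => hB (Finset.mem_of_mem_erase h)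
    exact Finset.notMem_erase v B ((isSep_star_iff h0).1 hsep hv)
  · rintro ⟨X', hsep, -, hlt⟩
    have h0 : 0 ∉ X' := by
      obtain ⟨s, hs, hsX, -⟩ := hlt.subset ((mem_RSet_star hB 0).2 hB)
      rwa [Finset.mem_singleton.1 hs] at hsX
    refine hlt.not_subset fun v hv => (mem_RSet_star hB v).2 fun hvB => ?_
    exact (mem_RSet_star h0 v).1 hv ((isSep_star_iff h0).1 hsep hvB)

theorem card_biUnion_powersetCard_Icc {α : Type*} [DecidableEq α] (T : Finset α) (k : ℕ) :
    ((Finset.Icc 1 k).biUnion fun i => T.powersetCard i).card = prefBinom T.card k := by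
  rw [Finset.card_biUnion fun i _ j _ hij => T.pairwise_disjoint_powersetCard hij]
  simp only [Finset.card_powersetCard, prefBinom]

/-- for every positive `k` there are infinitely many `c` for which some
digraph with `|S| = 1`, `|T| = c` has at least `C(|T|,≤k)` all-subsets important
separators of size at most `k`. -/
theorem lower_bound_sink_side (k : ℕ) (hk : 0 < k) :
    ∀ N : ℕ, ∃ c : ℕ, N < c ∧ 0 < c ∧
      ∃ (n : ℕ) (E : Fin n → Fin n → Prop) (S T : Finset (Fin n)),
        Disjoint S T ∧ S.card = 1 ∧ T.card = c ∧
        prefBinom T.card k ≤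
          {X : Finset (Fin n) | X.card ≤ k ∧ ∃ A ⊆ S, ∃ B ⊆ T, IsImpSep E A B X}.ncard := by
  intro N
  refine ⟨N + 1, N.lt_succ_self, N.succ_pos, N + 1 + 1, fun a b => a = 0 ∧ b ≠ 0, {0},
    Finset.univ.erase 0, by simp, by simp, by simp, ?_⟩
  rw [← card_biUnion_powersetCard_Icc, ← Set.ncard_coe_finset]
  refine Set.ncard_le_ncard (fun X hX => ?_) (Set.toFinite _)
  simp only [Finset.coe_biUnion, Set.mem_iUnion, Finset.mem_coe, Finset.mem_Icc,
    Finset.mem_powersetCard] at hX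
  obtain ⟨i, hi, hXT, hcard⟩ := hX
  exact ⟨hcard.trans_le hi.2, {0}, subset_rfl, X, hXT,
    isImpSep_star fun h => Finset.notMem_erase 0 _ (hXT h)⟩
end

section
/- For every positive integer k there exist infinitely many positive integers c with the following property: there is a digraph G and disjoint sets S, T ⊆ V(G) with |S| = c and |T| = k + 1 such that the number of distinct sets X ⊆ V(G) that are an important A-B separator of size at most k for some A ⊆ S and some B ⊆ T is at least C(|S|, ≤k). -/
theorem mem_RSet_of_edge {V : Type*} {E : V → V → Prop} {A X : Finset V} {a b : V}
    (ha : a ∈ A) (haX : a ∉ X) (hab : E a b) (hbX : b ∉ X) : b ∈ RSet E A X :=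
  ⟨a, ha, haX, Relation.ReflTransGen.single ⟨hab, hbX⟩⟩

theorem RSet_self {V : Type*} (E : V → V → Prop) (A : Finset V) : RSet E A A = ∅ := by
  ext v
  simp only [RSet, Set.mem_ofPred_eq, Set.mem_empty_iff_false, iff_false]
  rintro ⟨s, hs, hsA, -⟩
  exact hsA hs

/-- If every vertex of `A` has an arc to every vertex of a larger set `B` disjoint from `A`,
then `A` itself is an important `A`-`B` separator. -/
theorem isImpSep_self_of_complete {V : Type*} [DecidableEq V] {E : V → V → Prop}
    {A B : Finset V} (hdisj : Disjoint A B) (hE : ∀ a ∈ A, ∀ b ∈ B, E a b)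
    (hcard : A.card < B.card) : IsImpSep E A B A := by
  refine ⟨⟨fun b _ => by simp [RSet_self], fun v hv hsep => ?_⟩, ?_⟩
  · obtain ⟨b, hb⟩ := Finset.card_pos.mp (Nat.zero_lt_of_lt hcard)
    exact hsep b hb (mem_RSet_of_edge hv (Finset.notMem_erase v A) (hE v hv b hb)
      fun h => Finset.disjoint_right.mp hdisj hb (Finset.mem_of_mem_erase h))
  · rintro ⟨X, hsep, hX, hlt⟩
    obtain ⟨v, ⟨a, ha, haX, -⟩, -⟩ := Set.exists_of_ssubset hlt
    have hBX : B ⊆ X := fun b hb => by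
      by_contra hbX
      exact hsep b hb (mem_RSet_of_edge ha haX (hE a ha b hb) hbX)
    have := Finset.card_le_card hBX
    omega

theorem prefBinom_card_le_ncard {V : Type*} [Fintype V] [DecidableEq V] (S : Finset V) (k : ℕ)
    (F : Set (Finset V)) (hF : ∀ A ⊆ S, A.card ≤ k → A ∈ F) :
    prefBinom S.card k ≤ F.ncard := by
  have hunion : prefBinom S.card k =
      ((Finset.Icc 1 k).biUnion fun i => Finset.powersetCard i S).card := by
    rw [Finset.card_biUnion fun i _ j _ hij => Finset.pairwise_disjoint_powersetCard S hij]
    simp [prefBinom]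
  rw [hunion, ← Set.ncard_coe_finset]
  refine Set.ncard_le_ncard (fun A hA => ?_) (Set.toFinite F)
  simp only [Finset.coe_biUnion, Set.mem_iUnion, Finset.mem_coe, Finset.mem_Icc,
    Finset.mem_powersetCard] at hA
  obtain ⟨i, hi, hAS, rfl⟩ := hA
  exact hF A hAS hi.2

/-- for every positive `k` there are infinitely many `c` for which some
digraph with `|S| = c`, `|T| = k + 1` has at least `C(|S|,≤k)` all-subsets important
separators of size at most `k`. -/
theorem lower_bound_source_side (k : ℕ) (hk : 0 < k) :
    ∀ N : ℕ, ∃ c : ℕ, N < c ∧ 0 < c ∧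
      ∃ (n : ℕ) (E : Fin n → Fin n → Prop) (S T : Finset (Fin n)),
        Disjoint S T ∧ S.card = c ∧ T.card = k + 1 ∧
        prefBinom S.card k ≤
          {X : Finset (Fin n) | X.card ≤ k ∧ ∃ A ⊆ S, ∃ B ⊆ T, IsImpSep E A B X}.ncard := by
  intro N
  let S : Finset (Fin (N + 1 + (k + 1))) := Finset.univ.map (Fin.castAddEmb (k + 1))
  let T : Finset (Fin (N + 1 + (k + 1))) := Finset.univ.map (Fin.natAddEmb (N + 1))
  have hS : S.card = N + 1 := by simp [S]
  have hT : T.card = k + 1 := by simp [T]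
  have hST : Disjoint S T := by
    rw [Finset.disjoint_left]
    intro v hv hv'
    simp only [S, T, Finset.mem_map, Finset.mem_univ, true_and] at hv hv'
    obtain ⟨i, rfl⟩ := hv
    obtain ⟨j, hj⟩ := hv'
    have := congrArg Fin.val hj
    simp at this
    omega
  refine ⟨N + 1, N.lt_succ_self, N.succ_pos, N + 1 + (k + 1), fun a b => a ∈ S ∧ b ∈ T, S, T,
    hST, hS, hT, prefBinom_card_le_ncard S k _ fun A hA hAk => ⟨hAk, A, hA, T, subset_rfl, ?_⟩⟩
  exact isImpSep_self_of_complete (hST.mono_left hA) (fun a ha b hb => ⟨hA ha, hb⟩) (by omega)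
end

section
/- Let G be a digraph and let X, T ⊆ V(G). Then X is closest to T if and only if for every vertex v ∈ X there exist |X| + 1 directed paths in G, each starting at a vertex of X and ending at a vertex of T, such that the paths are pairwise vertex-disjoint except that v lies on exactly two of the paths (both of which start at v). -/
/-- `X` is closest to `T`: `X` is the unique `X`-`T` separator of size at most `|X|`. -/
def IsClosest {V : Type*} (E : V → V → Prop) (X T : Finset V) : Prop :=
  ∀ Y : Finset V, IsSep E X T Y → Y.card ≤ X.card → Y = X

/-- `l` is a directed walk of the relation `R` from a vertex of `A` to a vertex of `B`. -/
structure IsWalk {V : Type*} (R : V → V → Prop) (A B : Finset V) (l : List V) : Prop where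
  chain : l.IsChain R
  head : ∃ x ∈ A, l.head? = some x
  last : ∃ u ∈ B, l.getLast? = some u

/-- `S` meets every directed walk of `R` from `A` to `B`. -/
def MeetsWalks {V : Type*} (R : V → V → Prop) (A B S : Finset V) : Prop :=
  ∀ l, IsWalk R A B l → ∃ z ∈ l, z ∈ S

/-- A family of pairwise disjoint directed paths of `R` from `A` to `B`. -/
structure IsLinkage {V ι : Type*} (R : V → V → Prop) (A B : Finset V) (P : ι → List V) :
    Prop where
  walk : ∀ i, IsWalk R A B (P i)
  nodup : ∀ i, (P i).Nodup
  disjoint : ∀ i j, i ≠ j → ∀ u ∈ P i, u ∉ P j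

theorem List.exists_first_mem {V : Type*} (p : V → Prop) (l : List V) (h : ∃ z ∈ l, p z) :
    ∃ l₁ z l₂, l = l₁ ++ z :: l₂ ∧ p z ∧ ∀ a ∈ l₁, ¬ p a := by
  induction l with
  | nil => simp at h
  | cons a l ih =>
    by_cases ha : p a
    · exact ⟨[], a, l, by simp [ha]⟩
    · obtain ⟨l₁, z, l₂, h₁, h₂, h₃⟩ := ih (by grind)
      exact ⟨a :: l₁, z, l₂, by simp [h₁], h₂, by grind⟩

theorem List.exists_last_mem {V : Type*} (p : V → Prop) (l : List V) (h : ∃ z ∈ l, p z) :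
    ∃ l₁ z l₂, l = l₁ ++ z :: l₂ ∧ p z ∧ ∀ a ∈ l₂, ¬ p a := by
  obtain ⟨l₁, z, l₂, h₁, h₂, h₃⟩ := List.exists_first_mem p l.reverse (by simpa using h)
  refine ⟨l₂.reverse, z, l₁.reverse, ?_, h₂, by simpa using h₃⟩
  simpa using congrArg List.reverse h₁

theorem List.IsChain.imp_of_ne_left {V : Type*} {R R' : V → V → Prop} {x z : V} {l : List V}
    (h : (l ++ [z]).IsChain R) (hR : ∀ a b, R a b → a ≠ x → R' a b) (hx : x ∉ l) :
    (l ++ [z]).IsChain R' := by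
  induction l with
  | nil => simp
  | cons a l ih => cases l <;> grind

theorem List.IsChain.imp_of_ne_right {V : Type*} {R R' : V → V → Prop} {y z : V} {l : List V}
    (h : (z :: l).IsChain R) (hR : ∀ a b, R a b → b ≠ y → R' a b) (hy : y ∉ l) :
    (z :: l).IsChain R' := by
  induction l generalizing z with
  | nil => simp
  | cons a l ih => grind

theorem isChain_or_mem_of_insert {V : Type*} [DecidableEq V] {F : Finset (V × V)} {x y : V}
    {l : List V} (h : l.IsChain fun a b => (a, b) ∈ insert (x, y) F) :
    (l.IsChain fun a b => (a, b) ∈ F) ∨ (x ∈ l ∧ y ∈ l) := by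
  induction l with
  | nil => simp
  | cons a l ih => cases l <;> grind

theorem IsWalk.mono {V : Type*} {R R' : V → V → Prop} {A B : Finset V} {l : List V}
    (h : IsWalk R A B l) (hR : ∀ a b, R a b → R' a b) : IsWalk R' A B l :=
  ⟨h.chain.imp hR, h.head, h.last⟩

section Linkage

variable {V : Type*} {R : V → V → Prop} {A B : Finset V}

theorem IsLinkage.exists_index_last {k : ℕ} {P : Fin k → List V} (hP : IsLinkage R A B P)
    (hk : B.card = k) :
    ∃ p : B → List V, IsLinkage R A B p ∧ (∀ s, (p s).getLast? = some s.1) ∧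
      ∀ s, ∀ w ∈ B, w ∈ p s → w = s := by
  choose f hf hl using fun i => (hP.walk i).last
  have hinj : Function.Injective (fun i => (⟨f i, hf i⟩ : B)) := by
    intro i j hij
    by_contra hne
    have h : f i = f j := congrArg Subtype.val hij
    exact hP.disjoint i j hne (f i) (List.mem_of_getLast? (hl i))
      (h ▸ List.mem_of_getLast? (hl j))
  have hbij := (Fintype.bijective_iff_injective_and_card _).2 ⟨hinj, by simp [hk]⟩
  let e := Equiv.ofBijective _ hbij
  have he : ∀ s, f (e.symm s) = s.1 := fun s => congrArg Subtype.val (e.apply_symm_apply s)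
  have hlast : ∀ s : B, (P (e.symm s)).getLast? = some s.1 := fun s => by rw [hl, he]
  refine ⟨fun s => P (e.symm s), ⟨fun s => hP.walk _, fun s => hP.nodup _, fun s t hst =>
    hP.disjoint _ _ (by simpa using hst)⟩, hlast, ?_⟩
  intro s w hw hws
  by_contra hne
  exact hP.disjoint (e.symm s) (e.symm ⟨w, hw⟩) (by
    intro h; apply hne; rw [e.symm.injective h]) w hws (List.mem_of_getLast? (hlast ⟨w, hw⟩))

theorem IsLinkage.exists_index_head {k : ℕ} {P : Fin k → List V} (hP : IsLinkage R A B P)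
    (hk : A.card = k) :
    ∃ p : A → List V, IsLinkage R A B p ∧ (∀ s, (p s).head? = some s.1) ∧
      ∀ s, ∀ w ∈ A, w ∈ p s → w = s := by
  choose f hf hl using fun i => (hP.walk i).head
  have hinj : Function.Injective (fun i => (⟨f i, hf i⟩ : A)) := by
    intro i j hij
    by_contra hne
    have h : f i = f j := congrArg Subtype.val hij
    exact hP.disjoint i j hne (f i) (List.mem_of_head? (hl i))
      (h ▸ List.mem_of_head? (hl j))
  have hbij := (Fintype.bijective_iff_injective_and_card _).2 ⟨hinj, by simp [hk]⟩
  let e := Equiv.ofBijective _ hbij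
  have he : ∀ s, f (e.symm s) = s.1 := fun s => congrArg Subtype.val (e.apply_symm_apply s)
  have hhead : ∀ s : A, (P (e.symm s)).head? = some s.1 := fun s => by rw [hl, he]
  refine ⟨fun s => P (e.symm s), ⟨fun s => hP.walk _, fun s => hP.nodup _, fun s t hst =>
    hP.disjoint _ _ (by simpa using hst)⟩, hhead, ?_⟩
  intro s w hw hws
  by_contra hne
  exact hP.disjoint (e.symm s) (e.symm ⟨w, hw⟩) (by
    intro h; apply hne; rw [e.symm.injective h]) w hws (List.mem_of_head? (hhead ⟨w, hw⟩))

/-- A path that meets `S` at most in its last vertex and a path that meets `S` at most in its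
first vertex can only meet in `S` when `S` meets all walks from `A` to `B`. -/
theorem eq_of_mem_of_meetsWalks {S A' B' : Finset V} (hS : MeetsWalks R A B S) {p q : List V}
    (hp : IsWalk R A B' p) (hq : IsWalk R A' B q) (hpn : p.Nodup) (hqn : q.Nodup) {s t z : V}
    (hs : p.getLast? = some s) (ht : q.head? = some t) (hpS : ∀ w ∈ S, w ∈ p → w = s)
    (hqS : ∀ w ∈ S, w ∈ q → w = t) (hzp : z ∈ p) (hzq : z ∈ q) :
    z = s ∧ z = t ∧ z ∈ S := by
  obtain ⟨p₁, p₂, rfl⟩ := List.append_of_mem hzp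
  obtain ⟨q₁, q₂, rfl⟩ := List.append_of_mem hzq
  have hw : IsWalk R A B (p₁ ++ z :: q₂) := by
    refine ⟨?_, ?_, ?_⟩
    · exact List.isChain_split.2 ⟨(List.isChain_split.1 hp.chain).1,
        (List.isChain_split.1 hq.chain).2⟩
    · obtain ⟨a, ha, h⟩ := hp.head
      exact ⟨a, ha, by cases p₁ <;> simpa using h⟩
    · obtain ⟨a, ha, h⟩ := hq.last
      exact ⟨a, ha, by simpa using h⟩
  obtain ⟨w, hw, hwS⟩ := hS _ hw
  have key₁ : w ∈ p₁ ++ [z] → w = z ∧ w = s := by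
    intro h
    have hws := hpS w hwS (by grind)
    refine ⟨?_, hws⟩
    rcases List.eq_nil_or_concat p₂ with rfl | ⟨p₂, b, rfl⟩
    · grind
    · have : b = s := by
        rw [List.concat_eq_append, show p₁ ++ z :: (p₂ ++ [b]) = (p₁ ++ z :: p₂) ++ [b] by simp,
          List.getLast?_concat] at hs
        exact Option.some.inj hs
      grind
  have key₂ : w ∈ z :: q₂ → w = z ∧ w = t := by
    intro h
    have hwt := hqS w hwS (by grind)
    refine ⟨?_, hwt⟩
    cases q₁ <;> grind
  by_cases h₁ : w ∈ p₁ ++ [z]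
  · have h₂ : w ∈ z :: q₂ := by grind
    grind
  · grind

end Linkage

theorem meetsWalks_of_insert_left {V : Type*} [DecidableEq V] {F : Finset (V × V)} {x y : V}
    {A B S W : Finset V} (hS : MeetsWalks (fun a b => (a, b) ∈ F) A B S)
    (hW : MeetsWalks (fun a b => (a, b) ∈ F) A (insert x S) W) :
    MeetsWalks (fun a b => (a, b) ∈ insert (x, y) F) A B W := by
  intro l hl
  have hex : ∃ z ∈ l, z ∈ insert x S := by
    rcases isChain_or_mem_of_insert hl.chain with h | h
    · obtain ⟨z, hz, hzS⟩ := hS l ⟨h, hl.head, hl.last⟩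
      exact ⟨z, hz, by simp [hzS]⟩
    · exact ⟨x, h.1, by simp⟩
  obtain ⟨l₁, z, l₂, rfl, hz, hl₁⟩ := List.exists_first_mem _ _ hex
  suffices h : IsWalk (fun a b => (a, b) ∈ F) A (insert x S) (l₁ ++ [z]) by
    obtain ⟨w, hw, hwW⟩ := hW _ h
    exact ⟨w, by grind, hwW⟩
  refine ⟨?_, ?_, ⟨z, hz, by simp⟩⟩
  · exact (List.isChain_split.1 hl.chain).1.imp_of_ne_left (x := x) (by grind)
      fun h => hl₁ x h (by simp)
  · obtain ⟨a, ha, h⟩ := hl.head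
    exact ⟨a, ha, by cases l₁ <;> simpa using h⟩

theorem meetsWalks_of_insert_right {V : Type*} [DecidableEq V] {F : Finset (V × V)} {x y : V}
    {A B S W : Finset V} (hS : MeetsWalks (fun a b => (a, b) ∈ F) A B S)
    (hW : MeetsWalks (fun a b => (a, b) ∈ F) (insert y S) B W) :
    MeetsWalks (fun a b => (a, b) ∈ insert (x, y) F) A B W := by
  intro l hl
  have hex : ∃ z ∈ l, z ∈ insert y S := by
    rcases isChain_or_mem_of_insert hl.chain with h | h
    · obtain ⟨z, hz, hzS⟩ := hS l ⟨h, hl.head, hl.last⟩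
      exact ⟨z, hz, by simp [hzS]⟩
    · exact ⟨y, h.2, by simp⟩
  obtain ⟨l₁, z, l₂, rfl, hz, hl₂⟩ := List.exists_last_mem _ _ hex
  suffices h : IsWalk (fun a b => (a, b) ∈ F) (insert y S) B (z :: l₂) by
    obtain ⟨w, hw, hwW⟩ := hW _ h
    exact ⟨w, by grind, hwW⟩
  refine ⟨?_, ⟨z, hz, by simp⟩, ?_⟩
  · exact (List.isChain_split.1 hl.chain).2.imp_of_ne_right (y := y) (by grind)
      fun h => hl₂ y h (by simp)
  · obtain ⟨a, ha, h⟩ := hl.last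
    exact ⟨a, ha, by simpa using h⟩

/-- In Menger's theorem, the part to append to a path ending in `insert x S`: for a vertex of `S`
the rest of the path of `q` starting there, and for `x` the path of `q` starting at `y`. -/
theorem exists_continuation {V : Type*} [DecidableEq V] {F : Finset (V × V)} {x y : V}
    {A B S : Finset V} {p : ↥(insert x S) → List V} {q : ↥(insert y S) → List V}
    (hp : IsLinkage (fun a b => (a, b) ∈ F) A (insert x S) p)
    (hq : IsLinkage (fun a b => (a, b) ∈ F) (insert y S) B q)
    (hpl : ∀ s, (p s).getLast? = some s.1) (hqh : ∀ t, (q t).head? = some t.1) (hyS : y ∉ S)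
    (key : ∀ s t, ∀ z ∈ p s, z ∈ q t → z = s ∧ z = t ∧ z ∈ S) (s : ↥(insert x S)) :
    ∃ (r : List V) (t : ↥(insert y S)),
      (p s ++ r).IsChain (fun a b => (a, b) ∈ insert (x, y) F) ∧ r.Nodup ∧
      (∃ u ∈ B, (p s ++ r).getLast? = some u) ∧ (∀ w ∈ r, w ∈ q t) ∧
      (∀ s', ∀ w ∈ p s', w ∉ r) ∧ ((s.1 = x ∧ t.1 = y) ∨ (s.1 ∈ S ∧ s.1 = t.1)) := by
  have hmono : ∀ a b, (a, b) ∈ F → (a, b) ∈ insert (x, y) F := fun a b h =>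
    Finset.mem_insert_of_mem h
  obtain ⟨s, hs⟩ := s
  rcases Finset.mem_insert.1 hs with rfl | hsS
  · set t : ↥(insert y S) := ⟨y, by simp⟩ with ht
    refine ⟨q t, t, ?_, hq.nodup t, ?_, fun w hw => hw, ?_, by simp [ht]⟩
    · refine List.isChain_append.2 ⟨(hp.walk _).chain.imp hmono,
        (hq.walk _).chain.imp hmono, ?_⟩
      rw [hpl, hqh]
      simp [ht]
    · obtain ⟨u, hu, h⟩ := (hq.walk t).last
      exact ⟨u, hu, by simp [h]⟩
    · intro s' w hw hw'
      obtain ⟨-, h₂, h₃⟩ := key s' t w hw hw'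
      exact hyS (by simpa [h₂] using h₃)
  · set t : ↥(insert y S) := ⟨s, by simp [hsS]⟩ with ht
    obtain ⟨m, hm⟩ : ∃ m, q t = s :: m :=
      List.head?_eq_some_iff.1 (hqh t)
    have hmn := hq.nodup t
    rw [hm] at hmn
    have hmw := hq.walk t
    rw [hm] at hmw
    refine ⟨m, t, ?_, hmn.of_cons, ?_, fun w hw => by simp [hm, hw], ?_, by simp [ht, hsS]⟩
    · refine List.isChain_append.2 ⟨(hp.walk _).chain.imp hmono,
        hmw.chain.tail.imp hmono, ?_⟩
      rw [hpl]
      have := hmw.chain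
      cases m <;> grind
    · obtain ⟨u, hu, h⟩ := hmw.last
      refine ⟨u, hu, ?_⟩
      rw [List.getLast?_append, hpl]
      cases m <;> simp_all
    · intro s' w hw hw'
      obtain ⟨-, h₂, -⟩ := key s' t w hw (by simp [hm, hw'])
      have : w = s := h₂
      grind

/-- **Menger's theorem** for vertex-disjoint paths in a finite digraph. -/
theorem menger {V : Type*} [DecidableEq V] (F : Finset (V × V)) (A B : Finset V) (k : ℕ)
    (hk : ∀ S, MeetsWalks (fun a b => (a, b) ∈ F) A B S → k ≤ S.card) :
    ∃ P : Fin k → List V, IsLinkage (fun a b => (a, b) ∈ F) A B P := by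
  induction F using Finset.induction_on generalizing A B k with
  | empty =>
    have h := hk (A ∩ B) (by
      rintro (_ | ⟨a, _ | ⟨b, l⟩⟩) ⟨h₁, h₂, h₃⟩
      · simp at h₂
      · exact ⟨a, by simp, by simp_all⟩
      · simp at h₁)
    obtain ⟨C, hC, hCk⟩ := Finset.exists_subset_card_eq h
    let e := (C.equivFinOfCardEq hCk).symm
    refine ⟨fun i => [(e i).1], ⟨fun i => ⟨by simp, ?_, ?_⟩, by simp, ?_⟩⟩
    · exact ⟨_, (Finset.mem_inter.1 (hC (e i).2)).1, by simp⟩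
    · exact ⟨_, (Finset.mem_inter.1 (hC (e i).2)).2, by simp⟩
    · intro i j hij u hu hu'
      simp only [List.mem_singleton] at hu hu'
      exact hij (e.injective (Subtype.ext (hu.symm.trans hu')))
  | insert xy F _ ih =>
    obtain ⟨x, y⟩ := xy
    by_cases h : ∀ S, MeetsWalks (fun a b => (a, b) ∈ F) A B S → k ≤ S.card
    · obtain ⟨P, hP⟩ := ih A B k h
      exact ⟨P, fun i => (hP.walk i).mono fun a b h => by simp [h], hP.nodup, hP.disjoint⟩
    push Not at h
    obtain ⟨S, hS, hSk⟩ := h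
    have hx : k ≤ (insert x S).card := hk _ (meetsWalks_of_insert_left hS
      fun l hl => by
        obtain ⟨u, hu, h⟩ := hl.last
        exact ⟨u, List.mem_of_getLast? h, hu⟩)
    have hy : k ≤ (insert y S).card := hk _ (meetsWalks_of_insert_right hS
      fun l hl => by
        obtain ⟨u, hu, h⟩ := hl.head
        exact ⟨u, List.mem_of_head? h, hu⟩)
    have hxS : x ∉ S := fun h => by rw [Finset.insert_eq_of_mem h] at hx; omega
    have hyS : y ∉ S := fun h => by rw [Finset.insert_eq_of_mem h] at hy; omega
    have hxk : (insert x S).card = k := by rw [Finset.card_insert_of_notMem hxS] at *; omega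
    have hyk : (insert y S).card = k := by rw [Finset.card_insert_of_notMem hyS] at *; omega
    obtain ⟨_, hP⟩ := ih A (insert x S) k fun W hW => hk W (meetsWalks_of_insert_left hS hW)
    obtain ⟨_, hQ⟩ := ih (insert y S) B k fun W hW => hk W (meetsWalks_of_insert_right hS hW)
    obtain ⟨p, hp, hpl, hpm⟩ := hP.exists_index_last hxk
    obtain ⟨q, hq, hqh, hqm⟩ := hQ.exists_index_head hyk
    have key : ∀ s t, ∀ z ∈ p s, z ∈ q t → z = s ∧ z = t ∧ z ∈ S := fun s t z hz hz' =>
      eq_of_mem_of_meetsWalks hS (hp.walk s) (hq.walk t) (hp.nodup s) (hq.nodup t) (hpl s)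
        (hqh t) (fun w hw => hpm s w (by simp [hw])) (fun w hw => hqm t w (by simp [hw])) hz hz'
    have hr : ∀ s : ↥(insert x S), ∃ (r : List V) (t : ↥(insert y S)),
        (p s ++ r).IsChain (fun a b => (a, b) ∈ insert (x, y) F) ∧ r.Nodup ∧
        (∃ u ∈ B, (p s ++ r).getLast? = some u) ∧ (∀ w ∈ r, w ∈ q t) ∧
        (∀ s', ∀ w ∈ p s', w ∉ r) ∧ ((s.1 = x ∧ t.1 = y) ∨ (s.1 ∈ S ∧ s.1 = t.1)) :=
      exists_continuation hp hq hpl hqh hyS key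
    choose r t hrc hrn hrl hrq hrp hst using hr
    have ht : Function.Injective t := by
      intro a b hab
      have := hst a
      have := hst b
      apply Subtype.ext
      grind
    let e := ((insert x S).equivFinOfCardEq hxk).symm
    refine ⟨fun i => p (e i) ++ r (e i), ⟨fun i => ⟨hrc _, ?_, hrl _⟩, fun i => ?_, ?_⟩⟩
    · obtain ⟨a, ha, h⟩ := (hp.walk (e i)).head
      exact ⟨a, ha, by simp [h]⟩
    · exact List.nodup_append'.2 ⟨hp.nodup _, hrn _, fun w hw => hrp _ _ w hw⟩
    · intro i j hij u hu hu'
      have hne : e i ≠ e j := e.injective.ne hij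
      have h₁ := hp.disjoint _ _ hne u
      have h₂ := hq.disjoint _ _ (ht.ne hne) u
      have h₃ := hrq (e i) u
      have h₄ := hrq (e j) u
      have h₅ := hrp (e i) (e j) u
      have h₆ := hrp (e j) (e i) u
      grind

theorem isSep_iff_meetsWalks {V : Type*} {E : V → V → Prop} {A B Y : Finset V} :
    IsSep E A B Y ↔ MeetsWalks E A B Y := by
  constructor
  · intro h l hl
    by_contra! hY
    obtain ⟨a, ha, hla⟩ := hl.head
    obtain ⟨b, hb, hlb⟩ := hl.last
    obtain ⟨l, rfl⟩ := List.head?_eq_some_iff.1 hla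
    refine h b hb ⟨a, ha, hY a (by simp), ?_⟩
    have hc := hl.chain
    clear hl ha hla
    induction l generalizing a with
    | nil => simp_all [Relation.ReflTransGen.refl]
    | cons c l ih =>
      rw [List.isChain_cons_cons] at hc
      exact .head ⟨hc.1, hY c (by simp)⟩
        (ih c (fun z hz => hY z (by grind)) (by simpa using hlb) hc.2)
  · rintro h b hb ⟨a, ha, haY, hab⟩
    have hl : ∃ l, (a :: l).IsChain E ∧ (a :: l).getLast? = some b ∧ ∀ z ∈ l, z ∉ Y := by
      clear ha haY
      induction hab using Relation.ReflTransGen.head_induction_on with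
      | refl => exact ⟨[], by simp⟩
      | @head a c hac _ ih =>
        obtain ⟨l, hc, hl, hY⟩ := ih
        refine ⟨c :: l, List.isChain_cons_cons.2 ⟨hac.1, hc⟩, by simpa using hl, ?_⟩
        simpa using ⟨hac.2, hY⟩
    obtain ⟨l, hc, hl, hY⟩ := hl
    obtain ⟨z, hz, hzY⟩ := h (a :: l) ⟨hc, ⟨a, ha, by simp⟩, ⟨b, hb, hl⟩⟩
    grind

section Split

variable {V : Type*}

/-- The relation on `Option V` obtained from `E` by adding a copy `none` of `v` that has the
out-neighbours of `v` and no in-neighbours. -/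
def SplitAdj (E : V → V → Prop) (v : V) (a b : Option V) : Prop :=
  ∃ c, b = some c ∧ E (a.getD v) c

theorem SplitAdj.isChain_map {E : V → V → Prop} {v : V} {l : List (Option V)}
    (h : l.IsChain (SplitAdj E v)) : (l.map (·.getD v)).IsChain E := by
  rw [List.isChain_map]
  refine h.imp ?_
  rintro a _ ⟨c, rfl, h⟩
  exact h

theorem SplitAdj.isChain_map_some {E : V → V → Prop} {v : V} {l : List V}
    (h : l.IsChain E) : (l.map some).IsChain (SplitAdj E v) := by
  rw [List.isChain_map]
  exact h.imp fun a b h => ⟨b, rfl, h⟩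

variable [Fintype V] [DecidableEq V]

/-- The sources `X` together with the copy of `v`. -/
def splitSource (X : Finset V) : Finset (Option V) := insert none (X.image some)

/-- The vertices whose projection to `V` lies in `T`. -/
def splitTarget (v : V) (T : Finset V) : Finset (Option V) := {a | a.getD v ∈ T}

theorem IsClosest.card_lt_of_meetsWalks_split {E : V → V → Prop} {X T : Finset V}
    (h : IsClosest E X T) {v : V} (hv : v ∈ X) {S : Finset (Option V)}
    (hS : MeetsWalks (SplitAdj E v) (splitSource X) (splitTarget v T) S) :
    X.card + 1 ≤ S.card := by
  by_contra! hlt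
  have hmap : ∀ l, IsWalk E X T l →
      IsWalk (SplitAdj E v) (splitSource X) (splitTarget v T) (l.map some) := by
    rintro l ⟨hc, ⟨a, ha, hla⟩, ⟨b, hb, hlb⟩⟩
    exact ⟨SplitAdj.isChain_map_some hc, ⟨some a, by simp [splitSource, ha], by simp [hla]⟩,
      ⟨some b, by simp [splitTarget, hb], by simp [hlb]⟩⟩
  by_cases hvS : some v ∈ S ∧ none ∉ S
  · set Y : Finset V := S.eraseNone.erase v with hY
    have hcard : Y.card < S.card := by
      refine lt_of_lt_of_le (Finset.card_erase_lt_of_mem (by simpa using hvS.1)) ?_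
      rw [← Finset.card_image_of_injective _ (Option.some_injective V)]
      exact Finset.card_le_card fun a ha => by
        obtain ⟨b, hb, rfl⟩ := Finset.mem_image.1 ha
        simpa using hb
    have hXY := h Y (isSep_iff_meetsWalks.2 fun l hl => by
      by_cases hvl : v ∈ l
      · obtain ⟨l₁, z, l₂, rfl, rfl, hl₂⟩ := List.exists_last_mem (· = v) l ⟨v, hvl, rfl⟩
        suffices hw : IsWalk (SplitAdj E z) (splitSource X) (splitTarget z T)
            (none :: l₂.map some) by
          obtain ⟨w, hw, hwS⟩ := hS _ hw
          rcases List.mem_cons.1 hw with rfl | hw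
          · exact absurd hwS hvS.2
          · obtain ⟨a, ha, rfl⟩ := List.mem_map.1 hw
            exact ⟨a, by simp [ha], by simp [hY, hwS, hl₂ a ha]⟩
        refine ⟨?_, ⟨none, by simp [splitSource], rfl⟩, ?_⟩
        · have hc := (List.isChain_split.1 hl.chain).2
          cases l₂ with
          | nil => simp
          | cons c l₂ =>
            rw [List.isChain_cons_cons] at hc
            exact List.isChain_cons_cons.2 ⟨⟨c, rfl, hc.1⟩, SplitAdj.isChain_map_some hc.2⟩
        · obtain ⟨b, hb, h⟩ := hl.last
          rcases List.eq_nil_or_concat l₂ with rfl | ⟨m, c, rfl⟩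
          · exact ⟨none, by simp_all [splitTarget], rfl⟩
          · rw [List.getLast?_append, List.concat_eq_append, ← List.cons_append,
              List.getLast?_concat] at h
            obtain rfl : c = b := by simpa using h
            refine ⟨some c, by simpa [splitTarget] using hb, ?_⟩
            rw [List.concat_eq_append, List.map_append, ← List.cons_append]
            exact List.getLast?_concat
      · obtain ⟨w, hw, hwS⟩ := hS _ (hmap l hl)
        obtain ⟨a, ha, rfl⟩ := List.mem_map.1 hw
        refine ⟨a, ha, ?_⟩
        simp only [hY, Finset.mem_erase, Finset.mem_eraseNone]
        exact ⟨fun h => hvl (h ▸ ha), hwS⟩) (by omega)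
    rw [← hXY] at hv
    simp [hY] at hv
  · have hsub : S.eraseNone.image some ⊆ S := fun a ha => by
      obtain ⟨b, hb, rfl⟩ := Finset.mem_image.1 ha
      simpa using hb
    have hcard := Finset.card_le_card hsub
    rw [Finset.card_image_of_injective _ (Option.some_injective V)] at hcard
    have hXY := h S.eraseNone (isSep_iff_meetsWalks.2 fun l hl => by
      obtain ⟨w, hw, hwS⟩ := hS _ (hmap l hl)
      obtain ⟨a, ha, rfl⟩ := List.mem_map.1 hw
      exact ⟨a, ha, by simpa using hwS⟩) (by omega)
    rw [← hXY] at hv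
    have hnone : none ∈ S := by
      by_contra hnone
      exact hvS ⟨by simpa using hv, hnone⟩
    have hlt' := Finset.card_lt_card (Finset.ssubset_iff_subset_ne.2
      ⟨hsub, fun h => by rw [← h] at hnone; simp at hnone⟩)
    rw [Finset.card_image_of_injective _ (Option.some_injective V), hXY] at hlt'
    omega

/-- Menger's theorem applied to the digraph in which `v` is duplicated. -/
theorem IsClosest.exists_linkage_split {E : V → V → Prop} {X T : Finset V}
    (h : IsClosest E X T) {v : V} (hv : v ∈ X) :
    ∃ P : Fin (X.card + 1) → List (Option V),
      IsLinkage (SplitAdj E v) (splitSource X) (splitTarget v T) P := by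
  classical
  have hF : (fun a b => (a, b) ∈ ({e | SplitAdj E v e.1 e.2} : Finset (Option V × Option V)))
      = SplitAdj E v := by
    ext a b
    simp
  rw [← hF]
  refine menger _ _ _ _ fun S hS => h.card_lt_of_meetsWalks_split hv ?_
  rwa [hF] at hS

end Split

/-- `X` is closest to `T` iff for every `v ∈ X` there are `|X| + 1` directed
paths from `X` to `T`, pairwise vertex-disjoint except that `v` lies on exactly two of
them, both of which start at `v`. -/
theorem closest_iff_paths
    (V : Type*) [Fintype V] [DecidableEq V] (E : V → V → Prop) (X T : Finset V) :
    IsClosest E X T ↔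
      ∀ v ∈ X, ∃ P : Fin (X.card + 1) → List V,
        (∀ i, (P i).Chain' E ∧ (P i).Nodup ∧
          (∃ x ∈ X, (P i).head? = some x) ∧ (∃ u ∈ T, (P i).getLast? = some u)) ∧
        (∃ i j : Fin (X.card + 1), i ≠ j ∧
          (P i).head? = some v ∧ (P j).head? = some v ∧
          ∀ l, l ≠ i → l ≠ j → v ∉ P l) ∧
        (∀ u : V, u ≠ v → ∀ i j : Fin (X.card + 1), i ≠ j → u ∈ P i → u ∉ P j) := by
  constructor
  · intro h v hv
    obtain ⟨_, hQ⟩ := h.exists_linkage_split hv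
    have hcard : (splitSource X).card = X.card + 1 := by
      rw [splitSource, Finset.card_insert_of_notMem (by simp),
        Finset.card_image_of_injective _ (Option.some_injective V)]
    obtain ⟨p, hp, hph, hpm⟩ := hQ.exists_index_head hcard
    let e := ((splitSource X).equivFinOfCardEq hcard).symm
    have hnone : none ∈ splitSource X := by simp [splitSource]
    have hsome : some v ∈ splitSource X := by simp [splitSource, hv]
    have hmem : ∀ a : Option V, a.getD v = v → a ∈ splitSource X := by
      rintro (_ | a) ha
      · exact hnone
      · obtain rfl : a = v := ha
        exact hsome
    have hinj : ∀ a b : Option V, a.getD v = b.getD v → a ≠ b → a.getD v = v := by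
      rintro (_ | a) (_ | b) <;> simp_all
    refine ⟨fun i => (p (e i)).map (·.getD v), fun i => ⟨?_, ?_, ?_, ?_⟩, ?_, ?_⟩
    · exact SplitAdj.isChain_map (hp.walk _).chain
    · refine List.Nodup.map_on (fun a ha b hb hab => ?_) (hp.nodup _)
      by_contra hne
      have hav := hinj a b hab hne
      rw [hpm _ a (hmem a hav) ha, hpm _ b (hmem b (hab ▸ hav)) hb] at hne
      exact hne rfl
    · refine ⟨(e i).1.getD v, ?_, by simp [hph]⟩
      have := (e i).2
      generalize (e i).1 = a at this
      cases a <;> simp_all [splitSource]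
    · obtain ⟨b, hb, h⟩ := (hp.walk (e i)).last
      exact ⟨b.getD v, by simpa [splitTarget] using hb, by simp [h]⟩
    · refine ⟨e.symm ⟨none, hnone⟩, e.symm ⟨some v, hsome⟩, ?_, by simp [hph], by simp [hph], ?_⟩
      · simp
      · intro l hl₁ hl₂ hvl
        obtain ⟨a, ha, hav⟩ := List.mem_map.1 hvl
        have hae := hpm _ a (hmem a hav) ha
        rcases a with _ | a
        · exact hl₁ (e.eq_symm_apply.2 (Subtype.ext hae.symm))
        · obtain rfl : a = v := hav
          exact hl₂ (e.eq_symm_apply.2 (Subtype.ext hae.symm))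
    · intro u hu i j hij hi hj
      obtain ⟨a, ha, rfl⟩ := List.mem_map.1 hi
      obtain ⟨b, hb, hab⟩ := List.mem_map.1 hj
      obtain rfl : a = b := by
        by_contra hne
        exact hu (hinj a b hab.symm hne)
      exact hp.disjoint _ _ (e.injective.ne hij) a ha hb
  · intro h Y hY hcard
    rw [isSep_iff_meetsWalks] at hY
    by_contra hne
    obtain ⟨v, hv, hvY⟩ : ∃ v ∈ X, v ∉ Y := by
      by_contra! hsub
      exact hne (Finset.eq_of_subset_of_card_le hsub hcard).symm
    obtain ⟨P, hP, -, hd⟩ := h v hv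
    choose f hf hfY using fun i => hY (P i) ⟨(hP i).1, (hP i).2.2.1, (hP i).2.2.2⟩
    have hfinj : Function.Injective f := by
      intro i j hij
      by_contra hne
      exact hd (f i) (fun h => hvY (h ▸ hfY i)) i j hne (hf i) (hij ▸ hf j)
    have := Finset.card_le_card_of_injOn f (s := Finset.univ) (t := Y) (fun i _ => hfY i)
      hfinj.injOn
    simp at this
    omega
end

section
/- There is an absolute constant c₀ > 0 such that for every digraph G on n ≥ 1 vertices, every ε ∈ (0,1) and every positive integer k, setting f = min(⌈c₀ · (k/ε) · ln(1/ε)⌉, n), the number of subsets T ⊆ V(G) with |T| = f that are (ε,k) detection sets of G is at least (2/3) · binom(n, f). In particular, G has an (ε,k) detection set of size f. -/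
/-- `u` reaches `v` in `G∖F` by a directed path avoiding `F`. -/
def ReachAvoid {V : Type*} (E : V → V → Prop) (F : Finset V) (u v : V) : Prop :=
  u ∉ F ∧ Relation.ReflTransGen (fun a b => E a b ∧ b ∉ F) u v

/-- `C` is a strongly connected component of `G∖F` (an equivalence class of
mutual reachability in `G∖F`). -/
def IsSCC {V : Type*} (E : V → V → Prop) (F : Finset V) (C : Set V) : Prop :=
  ∃ u, u ∉ F ∧ C = {v | ReachAvoid E F u v ∧ ReachAvoid E F v u}

/-- `T` is an `(ε,k)` detection set: for every `F` of size `≤ k` and every partition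
`(A,B)` of `V∖F` with `|A|,|B| ≥ εn` and no arc of `G∖F` from `B` to `A`, some pair of
terminals is disconnected in `G∖F`. -/
def IsDetSet {V : Type*} [Fintype V] (E : V → V → Prop) (ε : ℝ) (k : ℕ)
    (T : Finset V) : Prop :=
  ∀ F : Finset V, F.card ≤ k →
    ∀ A B : Set V, A ∪ B = {v : V | v ∉ F} → Disjoint A B →
      ε * (Fintype.card V : ℝ) ≤ (A.ncard : ℝ) →
      ε * (Fintype.card V : ℝ) ≤ (B.ncard : ℝ) →
      (∀ b ∈ B, ∀ a ∈ A, ¬ E b a) →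
      ∃ t₁ ∈ T, ∃ t₂ ∈ T, ¬ ReachAvoid E F t₁ t₂

open Classical in
/-- The out-neighbourhood of `W`, as a set of vertices outside `W`. -/
noncomputable def outBoundary {V : Type*} [Fintype V] (E : V → V → Prop) (W : Finset V) :
    Finset V :=
  Finset.univ.filter fun b => b ∉ W ∧ ∃ a ∈ W, E a b

/-- Every vertex of `R` can be reached from `v` inside `R`, phrased through closed sets. -/
def ReachesWithin {V : Type*} (E : V → V → Prop) (v : V) (R : Finset V) : Prop :=
  v ∈ R ∧ ∀ M : Finset V, v ∈ M → (∀ a ∈ M, ∀ b ∈ R, E a b → b ∈ M) → R ⊆ M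

lemma mem_outBoundary {V : Type*} [Fintype V] {E : V → V → Prop} {W : Finset V} {b : V} :
    b ∈ outBoundary E W ↔ b ∉ W ∧ ∃ a ∈ W, E a b := by
  simp [outBoundary]

lemma disjoint_outBoundary {V : Type*} [Fintype V] {E : V → V → Prop} (W : Finset V) :
    Disjoint W (outBoundary E W) :=
  Finset.disjoint_left.2 fun _ hb h => (mem_outBoundary.1 h).1 hb

lemma exists_reachesWithin_subset {V : Type*} [Fintype V] {E : V → V → Prop} {v : V}
    {W : Finset V} (hv : v ∈ W) :
    ∃ R ⊆ W, ReachesWithin E v R ∧ outBoundary E R ⊆ outBoundary E W := by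
  classical
  let r : V → V → Prop := fun a b => E a b ∧ b ∈ W
  refine ⟨Finset.univ.filter fun w => Relation.ReflTransGen r v w, ?_, ⟨?_, ?_⟩, ?_⟩
  · intro w hw
    rcases (Finset.mem_filter.1 hw).2.cases_tail with h | ⟨c, -, h⟩
    · exact h ▸ hv
    · exact h.2
  · simpa using Relation.ReflTransGen.refl
  · intro M hvM hM w hw
    replace hw := (Finset.mem_filter.1 hw).2
    induction hw with
    | refl => exact hvM
    | tail hab hbc ih => exact hM _ ih _ (by simpa using hab.tail hbc) hbc.1
  · intro b hb
    obtain ⟨hbR, a, ha, hab⟩ := mem_outBoundary.1 hb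
    have ha' := (Finset.mem_filter.1 ha).2
    refine mem_outBoundary.2 ⟨fun hbW => hbR ?_, a, ?_, hab⟩
    · simpa using ha'.tail ⟨hab, hbW⟩
    · rcases ha'.cases_tail with h | ⟨c, -, h⟩
      · exact h ▸ hv
      · exact h.2

section Boundary

variable {V : Type*} [Fintype V] [DecidableEq V] {E : V → V → Prop}

lemma card_outBoundary_submodular (A B : Finset V) :
    (outBoundary E (A ∩ B)).card + (outBoundary E (A ∪ B)).card ≤
      (outBoundary E A).card + (outBoundary E B).card := by
  rw [← Finset.card_union_add_card_inter, ← Finset.card_union_add_card_inter (outBoundary E A)]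
  apply add_le_add <;> apply Finset.card_le_card <;> intro b <;>
    simp only [Finset.mem_union, Finset.mem_inter, mem_outBoundary] <;> grind

lemma exists_largest_minimizer {S Z U : Finset V} (hSU : S ⊆ U) (hUZ : Disjoint U Z) :
    ∃ M, S ⊆ M ∧ Disjoint M Z ∧
      (∀ W, S ⊆ W → Disjoint W Z → (outBoundary E M).card ≤ (outBoundary E W).card) ∧
      ∀ W, S ⊆ W → Disjoint W Z → (outBoundary E W).card ≤ (outBoundary E M).card → W ⊆ M := by
  obtain ⟨M₀, hM₀, hmin⟩ := Finset.exists_min_image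
    (Finset.univ.filter fun W => S ⊆ W ∧ Disjoint W Z) (fun W => (outBoundary E W).card)
    ⟨U, by simp [hSU, hUZ]⟩
  simp only [Finset.mem_filter, Finset.mem_univ, true_and, and_imp] at hM₀ hmin
  obtain ⟨M, hM, hmax⟩ := Finset.exists_max_image
    (Finset.univ.filter fun W => (S ⊆ W ∧ Disjoint W Z) ∧
      (outBoundary E W).card ≤ (outBoundary E M₀).card) Finset.card
    ⟨M₀, by simp [hM₀]⟩
  simp only [Finset.mem_filter, Finset.mem_univ, true_and, and_imp] at hM hmax
  refine ⟨M, hM.1.1, hM.1.2, fun W h1 h2 => hM.2.trans (hmin W h1 h2), fun W h1 h2 h3 => ?_⟩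
  have hsub := card_outBoundary_submodular (E := E) W M
  have hi := hmin (W ∩ M) (Finset.subset_inter h1 hM.1.1) (h2.mono_left Finset.inter_subset_left)
  have hu := hmax (W ∪ M) (h1.trans Finset.subset_union_left)
    (Finset.disjoint_union_left.2 ⟨h2, hM.1.2⟩) (by omega)
  rw [Finset.eq_of_subset_of_card_le Finset.subset_union_right hu]
  exact Finset.subset_union_left

/-- One step of a greedy choice of obstructions forcing a large boundary. -/
lemma exists_insert_obstruction {A Z Z₀ : Finset V} {p : ℕ}
    (hp : ∀ W, A ⊆ W → Disjoint W Z₀ → p ≤ (outBoundary E W).card)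
    (hZ : ∀ W, A ⊆ W → Disjoint W Z → p + 1 ≤ (outBoundary E W).card) :
    ∃ Y ⊆ Z, Y.card ≤ 1 ∧
      ∀ W, A ⊆ W → Disjoint W (Z₀ ∪ Y) → p + 1 ≤ (outBoundary E W).card := by
  by_cases hex : ∃ W, (A ⊆ W ∧ Disjoint W Z₀) ∧ (outBoundary E W).card ≤ p
  · obtain ⟨W₀, hW₀⟩ := hex
    obtain ⟨m, hm, hmin⟩ := Finset.exists_min_image
      (Finset.univ.filter fun W => (A ⊆ W ∧ Disjoint W Z₀) ∧ (outBoundary E W).card ≤ p)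
      Finset.card ⟨W₀, by simpa using hW₀⟩
    simp only [Finset.mem_filter, Finset.mem_univ, true_and, and_imp] at hm hmin
    have hmZ : ¬ Disjoint m Z := fun h => by
      have := hZ m hm.1.1 h
      omega
    obtain ⟨z, hzm, hzZ⟩ := Finset.not_disjoint_iff.1 hmZ
    refine ⟨{z}, by simpa using hzZ, by simp, fun W hAW hW => ?_⟩
    obtain ⟨hWZ, hWz⟩ := Finset.disjoint_union_right.1 hW
    by_contra! hlt
    have hsub := card_outBoundary_submodular (E := E) W m
    have hu := hp (W ∪ m) (hAW.trans Finset.subset_union_left)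
      (Finset.disjoint_union_left.2 ⟨hWZ, hm.1.2⟩)
    have hi := hmin (W ∩ m) (Finset.subset_inter hAW hm.1.1)
      (hWZ.mono_left Finset.inter_subset_left) (by omega)
    have heq := Finset.eq_of_subset_of_card_le Finset.inter_subset_right hi
    exact Finset.disjoint_singleton_right.1 hWz
      (Finset.mem_inter.1 ((Finset.ext_iff.1 heq z).2 hzm)).1
  · push Not at hex
    exact ⟨∅, by simp, by simp, fun W h1 h2 => hex W ⟨h1, by simpa using h2⟩⟩

lemma exists_small_obstruction {A Z : Finset V} {q : ℕ}
    (hZ : ∀ W, A ⊆ W → Disjoint W Z → q ≤ (outBoundary E W).card) :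
    ∃ Y ⊆ Z, Y.card ≤ q ∧ ∀ W, A ⊆ W → Disjoint W Y → q ≤ (outBoundary E W).card := by
  induction q with
  | zero => exact ⟨∅, by simp⟩
  | succ q ih =>
    obtain ⟨Y₀, hY₀, hc₀, h₀⟩ := ih fun W h1 h2 => (Nat.le_succ q).trans (hZ W h1 h2)
    obtain ⟨Y, hY, hc, h⟩ := exists_insert_obstruction h₀ hZ
    refine ⟨Y₀ ∪ Y, Finset.union_subset hY₀ hY, ?_, h⟩
    have := Finset.card_union_le Y₀ Y
    omega

/-- `U` is a *`Z`-important* set for the boundary `F`: swallowing a vertex of `F` while avoiding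
`Z` strictly increases the boundary. -/
def IsImportant (E : V → V → Prop) (Z F U : Finset V) : Prop :=
  Disjoint U Z ∧ outBoundary E U = F ∧
    ∀ W, U ⊆ W → Disjoint W Z → ¬ Disjoint W F → F.card < (outBoundary E W).card

lemma IsImportant.exists_small_obstruction {Z F U : Finset V} (h : IsImportant E Z F U) :
    ∃ Y ⊆ Z, Y.card ≤ 2 * F.card ∧ IsImportant E Y F U := by
  obtain ⟨hUZ, rfl, himp⟩ := h
  have hbase : ∀ W, U ⊆ W → Disjoint W Z →
      (outBoundary E U).card ≤ (outBoundary E W).card := by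
    intro W hUW hWZ
    by_cases hd : Disjoint W (outBoundary E U)
    · refine Finset.card_le_card fun b hb => mem_outBoundary.2 ⟨?_, ?_⟩
      · exact fun hbW => Finset.disjoint_left.1 hd hbW hb
      · obtain ⟨-, a, ha, hab⟩ := mem_outBoundary.1 hb
        exact ⟨a, hUW ha, hab⟩
    · exact (himp W hUW hWZ hd).le
  obtain ⟨Y₀, hY₀, hc₀, h₀⟩ := _root_.exists_small_obstruction hbase
  have hstep : ∀ b ∈ outBoundary E U, ∃ Y ⊆ Z, Y.card ≤ 1 ∧
      ∀ W, insert b U ⊆ W → Disjoint W (Y₀ ∪ Y) →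
        (outBoundary E U).card + 1 ≤ (outBoundary E W).card := by
    intro b hb
    refine exists_insert_obstruction
      (fun W hW hWY => h₀ W ((Finset.subset_insert _ _).trans hW) hWY) fun W hW hWZ => ?_
    exact himp W ((Finset.subset_insert _ _).trans hW) hWZ
      (Finset.not_disjoint_iff.2 ⟨b, hW (Finset.mem_insert_self _ _), hb⟩)
  choose! Y hYZ hYc hY using hstep
  refine ⟨Y₀ ∪ (outBoundary E U).biUnion Y, ?_, ?_, ?_, rfl, ?_⟩
  · exact Finset.union_subset hY₀ (Finset.biUnion_subset.2 hYZ)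
  · have h1 := Finset.card_union_le Y₀ ((outBoundary E U).biUnion Y)
    have h2 := Finset.card_biUnion_le_card_mul (outBoundary E U) Y 1 hYc
    omega
  · exact hUZ.mono_right (Finset.union_subset hY₀ (Finset.biUnion_subset.2 hYZ))
  · intro W hUW hWY hWF
    obtain ⟨b, hbW, hb⟩ := Finset.not_disjoint_iff.1 hWF
    refine hY b hb W (Finset.insert_subset hbW hUW) (hWY.mono_right ?_)
    exact Finset.union_subset_union_right (Finset.subset_biUnion_of_mem Y hb)

lemma ReachesWithin.subset_of_outBoundary_subset {v : V} {R M : Finset V}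
    (hR : ReachesWithin E v R) (hv : v ∈ M) (hM : outBoundary E M ⊆ outBoundary E R) :
    R ⊆ M := by
  refine hR.2 M hv fun a ha b hb hab => ?_
  by_contra hbM
  exact (mem_outBoundary.1 (hM (mem_outBoundary.2 ⟨hbM, a, ha, hab⟩))).1 hb

/-- There are at most `4 ^ k` important boundaries of size at most `k`: the branching bound,
where `S` has been put inside the important set and `D` into its boundary. -/
lemma card_important_le {v : V} {k : ℕ} {Z : Finset V} (t : ℕ) :
    ∀ (S D : Finset V) (l : ℕ), v ∈ S →
      (∀ W, S ⊆ W → Disjoint W (Z ∪ D) → l ≤ (outBoundary E W).card) →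
      2 * k ≤ t + l + D.card →
      ∀ 𝓡 : Finset (Finset V),
        (∀ R ∈ 𝓡, ReachesWithin E v R ∧ (outBoundary E R).card ≤ k ∧ D ⊆ outBoundary E R ∧
          ∃ U, S ⊆ U ∧ IsImportant E Z (outBoundary E R) U) →
        𝓡.card ≤ 2 ^ t := by
  have hone : ∀ (D : Finset V) (𝓡 : Finset (Finset V)),
      (∀ R ∈ 𝓡, ReachesWithin E v R ∧ outBoundary E R = D) → 𝓡.card ≤ 1 := by
    intro D 𝓡 h
    refine Finset.card_le_one.2 fun R hR R' hR' => ?_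
    obtain ⟨h1, h2⟩ := h R hR
    obtain ⟨h3, h4⟩ := h R' hR'
    exact (h1.subset_of_outBoundary_subset h3.1 (by rw [h2, h4])).antisymm
      (h3.subset_of_outBoundary_subset h1.1 (by rw [h2, h4]))
  have hdisj : ∀ {D F U : Finset V}, D ⊆ F → IsImportant E Z F U → Disjoint U (Z ∪ D) := by
    intro D F U hDF hU
    refine Finset.disjoint_union_right.2 ⟨hU.1, ?_⟩
    exact (hU.2.1 ▸ disjoint_outBoundary U : Disjoint U F).mono_right hDF
  induction t with
  | zero =>
    intro S D l hv hl ht 𝓡 h𝓡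
    refine hone D 𝓡 fun R hR => ?_
    obtain ⟨h1, h2, h3, U, hSU, hU⟩ := h𝓡 R hR
    have h4 := hl U hSU (hdisj h3 hU)
    rw [hU.2.1] at h4
    exact ⟨h1, (Finset.eq_of_subset_of_card_le h3 (by omega)).symm⟩
  | succ t ih =>
    intro S D l hv hl ht 𝓡 h𝓡
    obtain rfl | ⟨R₀, hR₀⟩ := 𝓡.eq_empty_or_nonempty
    · simp
    obtain ⟨-, -, h3, U₀, hSU₀, hU₀⟩ := h𝓡 R₀ hR₀
    obtain ⟨M, hSM, hMZ, hmin, hmax⟩ :=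
      exists_largest_minimizer (E := E) hSU₀ (hdisj h3 hU₀)
    have hext : ∀ R ∈ 𝓡, Disjoint M (outBoundary E R) ∧
        ∃ U, S ⊆ U ∧ M ⊆ U ∧ IsImportant E Z (outBoundary E R) U := by
      intro R hR
      obtain ⟨-, -, hDR, U, hSU, hU⟩ := h𝓡 R hR
      have hUD := hdisj hDR hU
      obtain ⟨hUZ, hUR, himp⟩ := hU
      have hsub := card_outBoundary_submodular (E := E) U M
      have hi := hmin (U ∩ M) (Finset.subset_inter hSU hSM)
        (hUD.mono_left Finset.inter_subset_left)
      have hUMZ : Disjoint (U ∪ M) Z :=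
        Finset.disjoint_union_left.2 ⟨hUZ, hMZ.mono_right Finset.subset_union_left⟩
      have hMR : Disjoint M (outBoundary E R) := by
        by_contra hcon
        have := himp (U ∪ M) Finset.subset_union_left hUMZ
          fun h => hcon (h.mono_left Finset.subset_union_right)
        rw [← hUR] at this
        omega
      refine ⟨hMR, U ∪ M, hSU.trans Finset.subset_union_left, Finset.subset_union_right, hUMZ,
        ?_, fun W hW => himp W (Finset.subset_union_left.trans hW)⟩
      rw [← hUR]
      refine (Finset.eq_of_subset_of_card_le (fun b hb => ?_) (by omega)).symm
      obtain ⟨hbU, a, ha, hab⟩ := mem_outBoundary.1 hb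
      refine mem_outBoundary.2 ⟨?_, a, Finset.mem_union_left _ ha, hab⟩
      rw [Finset.mem_union, not_or]
      exact ⟨hbU, fun hbM => Finset.disjoint_left.1 hMR hbM (hUR ▸ hb)⟩
    by_cases hMD : outBoundary E M ⊆ D
    · refine (hone D 𝓡 fun R hR => ?_).trans Nat.one_le_two_pow
      obtain ⟨h1, -, hDR, -⟩ := h𝓡 R hR
      refine ⟨h1, Finset.Subset.antisymm (fun b hb => hMD ?_) hDR⟩
      have hRM := h1.subset_of_outBoundary_subset (hSM hv) (hMD.trans hDR)
      obtain ⟨-, a, ha, hab⟩ := mem_outBoundary.1 hb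
      exact mem_outBoundary.2
        ⟨fun hbM => Finset.disjoint_left.1 (hext R hR).1 hbM hb, a, hRM ha, hab⟩
    · obtain ⟨w, hwM, hwD⟩ := Finset.not_subset.1 hMD
      rw [← Finset.card_filter_add_card_filter_not (s := 𝓡) (fun R => w ∈ outBoundary E R),
        pow_succ, mul_two]
      obtain ⟨hwM', c, hc, hcw⟩ := mem_outBoundary.1 hwM
      refine add_le_add (ih S (insert w D) l hv ?_ ?_ _ ?_)
        (ih (insert w M) D (l + 1) ?_ ?_ ?_ _ ?_)
      · exact fun W h1 h2 => hl W h1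
          (h2.mono_right (Finset.union_subset_union_right (Finset.subset_insert _ _)))
      · rw [Finset.card_insert_of_notMem hwD]
        omega
      · intro R hR
        obtain ⟨hR, hwR⟩ := Finset.mem_filter.1 hR
        obtain ⟨h1, h2, h3, h4⟩ := h𝓡 R hR
        exact ⟨h1, h2, Finset.insert_subset hwR h3, h4⟩
      · exact Finset.mem_insert_of_mem (hSM hv)
      · intro W h1 h2
        have hMW : M ⊆ W := (Finset.subset_insert _ _).trans h1
        have h3 := hl M hSM hMZ
        by_contra! hlt
        exact hwM' (hmax W (hSM.trans hMW) h2 (by omega) (h1 (Finset.mem_insert_self _ _)))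
      · omega
      · intro R hR
        obtain ⟨hR, hwR⟩ := Finset.mem_filter.1 hR
        obtain ⟨h1, h2, h3, -⟩ := h𝓡 R hR
        obtain ⟨-, U, -, hMU, hU⟩ := hext R hR
        refine ⟨h1, h2, h3, U, Finset.insert_subset ?_ hMU, hU⟩
        by_contra hwU
        exact hwR (hU.2.1 ▸ mem_outBoundary.2 ⟨hwU, c, hMU hc, hcw⟩)

/-- Enlarging a reachable set with small boundary, without meeting `Z`, until it is important. -/
lemma exists_important_reachesWithin {v : V} {k : ℕ} {Z R₀ : Finset V}
    (h₀ : ReachesWithin E v R₀) (hk : (outBoundary E R₀).card ≤ k) (hZ : Disjoint R₀ Z) :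
    ∃ R, R₀ ⊆ R ∧ ReachesWithin E v R ∧ (outBoundary E R).card ≤ k ∧
      IsImportant E Z (outBoundary E R) R := by
  classical
  obtain ⟨R, hR, hmax⟩ := Finset.exists_max_image
    (Finset.univ.filter fun R => R₀ ⊆ R ∧ ReachesWithin E v R ∧ (outBoundary E R).card ≤ k ∧
      Disjoint R Z) Finset.card ⟨R₀, by simp [h₀, hk, hZ]⟩
  simp only [Finset.mem_filter, Finset.mem_univ, true_and, and_imp] at hR hmax
  obtain ⟨hR₀, hRv, hRk, hRZ⟩ := hR
  refine ⟨R, hR₀, hRv, hRk, hRZ, rfl, fun W hRW hWZ hWF => ?_⟩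
  by_contra! hle
  obtain ⟨b, hbW, hb⟩ := Finset.not_disjoint_iff.1 hWF
  obtain ⟨R', hR'W, hR'v, hR'b⟩ := exists_reachesWithin_subset (E := E) (hRW hRv.1)
  have hclosed : ∀ a ∈ R', ∀ c ∈ W, E a c → c ∈ R' := by
    intro a ha c hc hac
    by_contra hcR
    exact (mem_outBoundary.1 (hR'b (mem_outBoundary.2 ⟨hcR, a, ha, hac⟩))).1 hc
  have hRR' : R ⊆ R' := hRv.2 R' hR'v.1 fun a ha c hc hac => hclosed a ha c (hRW hc) hac
  have hcard := hmax R' (hR₀.trans hRR') hR'v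
    ((Finset.card_le_card hR'b).trans (hle.trans hRk)) (hWZ.mono_left hR'W)
  have heq := Finset.eq_of_subset_of_card_le hRR' hcard
  obtain ⟨hbR, a, ha, hab⟩ := mem_outBoundary.1 hb
  exact hbR (heq ▸ hclosed a (hRR' ha) b hbW hab)

/-- The number of traces on `X` of sets reachable from `v` with boundary of size at most `k`. -/
lemma card_reach_traces_le (v : V) (k : ℕ) (X : Finset V) (𝓠 : Finset (Finset V))
    (h𝓠 : ∀ Q ∈ 𝓠, ∃ R, ReachesWithin E v R ∧ (outBoundary E R).card ≤ k ∧ Q = R ∩ X) :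
    𝓠.card ≤ (X.powerset.filter fun Y => Y.card ≤ 2 * k).card * 4 ^ k := by
  classical
  let 𝓡 : Finset V → Finset (Finset V) := fun Y => Finset.univ.filter fun R =>
    ReachesWithin E v R ∧ (outBoundary E R).card ≤ k ∧ IsImportant E Y (outBoundary E R) R
  have hcard : ∀ Y, ((𝓡 Y).image (· ∩ X)).card ≤ 4 ^ k := by
    intro Y
    refine Finset.card_image_le.trans ?_
    rw [show (4 : ℕ) ^ k = 2 ^ (2 * k) by rw [pow_mul]; norm_num]
    refine card_important_le (E := E) (v := v) (k := k) (Z := Y) (2 * k) {v} ∅ 0 (by simp)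
      (by simp) (by simp) _ fun R hR => ?_
    obtain ⟨h1, h2, h3⟩ := (Finset.mem_filter.1 hR).2
    exact ⟨h1, h2, by simp, R, by simpa using h1.1, h3⟩
  refine (Finset.card_le_card (t := (X.powerset.filter fun Y => Y.card ≤ 2 * k).biUnion
    fun Y => (𝓡 Y).image (· ∩ X)) fun Q hQ => ?_).trans
      (Finset.card_biUnion_le_card_mul _ _ _ fun Y _ => hcard Y)
  obtain ⟨R₀, h₀, hk, rfl⟩ := h𝓠 Q hQ
  obtain ⟨R, hR₀, hRv, hRk, hRi⟩ := exists_important_reachesWithin h₀ hk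
    (Finset.disjoint_sdiff (s := R₀) (t := X))
  obtain ⟨Y, hYZ, hYc, hY⟩ := hRi.exists_small_obstruction
  refine Finset.mem_biUnion.2 ⟨Y, ?_, Finset.mem_image.2 ⟨R, ?_, ?_⟩⟩
  · refine Finset.mem_filter.2 ⟨Finset.mem_powerset.2 (hYZ.trans Finset.sdiff_subset), ?_⟩
    omega
  · exact Finset.mem_filter.2 ⟨Finset.mem_univ _, hRv, hRk, hY⟩
  · have hd := hRi.1
    ext b
    rw [Finset.mem_inter, Finset.mem_inter]
    refine ⟨fun h => ⟨?_, h.2⟩, fun h => ⟨hR₀ h.1, h.2⟩⟩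
    by_contra hb
    exact Finset.disjoint_left.1 hd h.1 (Finset.mem_sdiff.2 ⟨h.2, hb⟩)

end Boundary

section Sampling

lemma two_pow_mul_choose_sub_le {m f : ℕ} (hf : 1 ≤ f) (hm : m ≤ 2 * f) (s : ℕ) :
    2 ^ s * (m - s).choose f ≤ m.choose f := by
  obtain ⟨e, rfl⟩ : ∃ e, f = e + 1 := ⟨f - 1, by omega⟩
  induction s with
  | zero => simp
  | succ s ih =>
    rcases Nat.eq_zero_or_pos (m - s) with h | h
    · rw [show m - (s + 1) = 0 by omega]
      simp
    · obtain ⟨p, hp⟩ : ∃ p, m - s = p + 1 := ⟨m - s - 1, by omega⟩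
      refine le_trans ?_ ih
      rw [hp, show m - (s + 1) = p by omega, pow_succ, mul_assoc]
      refine Nat.mul_le_mul_left _ ?_
      have h1 := Nat.choose_mul_succ_eq p (e + 1)
      have h2 : p + 1 - (e + 1) ≤ e + 1 := by omega
      have h3 : p.choose (e + 1) ≤ p.choose e := by
        have h4 := Nat.choose_succ_right_eq p e
        have h5 : p.choose (e + 1) * (e + 1) ≤ p.choose e * (e + 1) := by
          rw [h4]
          exact Nat.mul_le_mul_left _ (by omega)
        exact Nat.le_of_mul_le_mul_right h5 (Nat.succ_pos e)
      rw [Nat.choose_succ_succ']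
      omega

/-- A positive proportion of the `j`-subsets of `U` meet a set of density `ε` in at least half the
expected number of points. -/
lemma half_mul_choose_le_card {V : Type*} [DecidableEq V] {U B : Finset V} (hB : B ⊆ U) {ε : ℝ}
    (hε : 0 ≤ ε) (hd : ε * U.card ≤ B.card) {j s : ℕ} (hj : 1 ≤ j) (hs : (s : ℝ) ≤ ε * j / 2 + 1) :
    ε / 2 * (U.card.choose j : ℝ) ≤
      (((Finset.powersetCard j U).filter fun Y => s ≤ (B ∩ Y).card).card : ℝ) := by
  obtain ⟨i, rfl⟩ : ∃ i, j = i + 1 := ⟨j - 1, by omega⟩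
  rcases B.eq_empty_or_nonempty with rfl | ⟨b₀, hb₀⟩
  · have hz : ε * U.card = 0 := le_antisymm (by simpa using hd) (by positivity)
    rcases mul_eq_zero.1 hz with h | h
    · simp [h]
    · have : U.card = 0 := by exact_mod_cast h
      rw [this]
      simp
  obtain ⟨p, hp⟩ : ∃ p, U.card = p + 1 :=
    ⟨U.card - 1, by have := Finset.card_pos.2 ⟨b₀, hB hb₀⟩; omega⟩
  have hsum : ∑ Y ∈ Finset.powersetCard (i + 1) U, (B ∩ Y).card = B.card * p.choose i := by
    refine Finset.sum_card_inter fun b hb => ?_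
    have := Finset.card_filter_powersetCard_subset {b} U (i + 1)
    simpa [hB hb, hp] using this
  set 𝓖 := (Finset.powersetCard (i + 1) U).filter fun Y => s ≤ (B ∩ Y).card with h𝓖
  have hup : (∑ Y ∈ Finset.powersetCard (i + 1) U, ((B ∩ Y).card : ℝ)) ≤
      𝓖.card * (i + 1 : ℝ) + U.card.choose (i + 1) * (ε * (i + 1) / 2) := by
    rw [← Finset.card_powersetCard, ← nsmul_eq_mul, ← nsmul_eq_mul, ← Finset.sum_const,
      ← Finset.sum_const, h𝓖, Finset.sum_filter, ← Finset.sum_add_distrib]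
    refine Finset.sum_le_sum fun Y hY => ?_
    split_ifs with h
    · have h1 : (B ∩ Y).card ≤ i + 1 :=
        (Finset.card_le_card Finset.inter_subset_right).trans (Finset.mem_powersetCard.1 hY).2.le
      have h2 : ((B ∩ Y).card : ℝ) ≤ i + 1 := by exact_mod_cast h1
      have : 0 ≤ ε * (i + 1) / 2 := by positivity
      linarith
    · have h1 : (B ∩ Y).card + 1 ≤ s := by omega
      have h2 : ((B ∩ Y).card : ℝ) + 1 ≤ s := by exact_mod_cast h1
      push_cast at hs
      linarith
  have hlow : ε * (i + 1) * (U.card.choose (i + 1) : ℝ) ≤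
      ∑ Y ∈ Finset.powersetCard (i + 1) U, ((B ∩ Y).card : ℝ) := by
    rw [← Nat.cast_sum, hsum]
    have h1 : ((p : ℝ) + 1) * p.choose i = (p + 1).choose (i + 1) * (i + 1) := by
      exact_mod_cast Nat.add_one_mul_choose_eq p i
    rw [hp] at hd ⊢
    push_cast at hd ⊢
    calc ε * (i + 1) * ((p + 1).choose (i + 1) : ℝ) = ε * (p + 1) * p.choose i := by
          linear_combination -ε * h1
      _ ≤ _ := by gcongr
  have hi : (0 : ℝ) < i + 1 := by positivity
  refine le_of_mul_le_mul_right ?_ hi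
  linarith

/-- Double sampling: if the bad `f`-sets are contained in sets of `𝓢` that miss many points of many
`m`-sets, and `𝓢` has few traces on `m`-sets, then there are few bad `f`-sets. -/
lemma card_bad_le {V : Type*} [Fintype V] [DecidableEq V] {𝓢 𝓑 : Finset (Finset V)}
    {f m s g : ℕ} {δ : ℝ} (hf : 1 ≤ f) (hfm : f ≤ m) (hm : m ≤ 2 * f) (hmn : m ≤ Fintype.card V)
    (h𝓑 : ∀ T ∈ 𝓑, T.card = f ∧ ∃ C ∈ 𝓢, T ⊆ C ∧
      δ * ((Fintype.card V - f).choose (m - f) : ℝ) ≤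
        (((Finset.powersetCard m Finset.univ).filter
          fun X => T ⊆ X ∧ s ≤ (X \ C).card).card : ℝ))
    (hg : ∀ X : Finset V, X.card = m →
      (((𝓢.image (· ∩ X)).filter Finset.Nonempty).card ≤ g)) :
    δ * 2 ^ s * (𝓑.card : ℝ) ≤ g * ((Fintype.card V).choose f : ℝ) := by
  classical
  set n := Fintype.card V with hn
  let r : Finset V → Finset V → Prop := fun T X => T ⊆ X ∧ ∃ C ∈ 𝓢, T ⊆ C ∧ s ≤ (X \ C).card
  have hdc := Finset.sum_card_bipartiteAbove_eq_sum_card_bipartiteBelow r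
    (s := 𝓑) (t := Finset.powersetCard m Finset.univ)
  have hlow : (𝓑.card : ℝ) * (δ * ((n - f).choose (m - f) : ℝ)) ≤
      ((∑ T ∈ 𝓑, (Finset.bipartiteAbove r (Finset.powersetCard m Finset.univ) T).card : ℕ) : ℝ) := by
    rw [Nat.cast_sum, ← nsmul_eq_mul]
    refine Finset.card_nsmul_le_sum _ _ _ fun T hT => ?_
    obtain ⟨-, C, hC, hTC, hle⟩ := h𝓑 T hT
    refine hle.trans (Nat.cast_le.2 (Finset.card_le_card fun X hX => ?_))
    obtain ⟨hX, hTX, hsX⟩ := Finset.mem_filter.1 hX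
    exact (Finset.mem_bipartiteAbove _).2 ⟨hX, hTX, C, hC, hTC, hsX⟩
  have hup : ∑ X ∈ Finset.powersetCard m Finset.univ, (Finset.bipartiteBelow r 𝓑 X).card ≤
      n.choose m * (g * (m - s).choose f) := by
    refine (Finset.sum_le_card_nsmul _ _ (g * (m - s).choose f) fun X hX => ?_).trans
      (by rw [Finset.card_powersetCard, Finset.card_univ, smul_eq_mul])
    have hXm := (Finset.mem_powersetCard.1 hX).2
    refine (Finset.card_le_card (t := (((𝓢.image (· ∩ X)).filter Finset.Nonempty).filter
      fun Q => Q.card ≤ m - s).biUnion fun Q => Finset.powersetCard f Q) fun T hT => ?_).trans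
        ((Finset.card_biUnion_le_card_mul _ _ ((m - s).choose f) fun Q hQ => ?_).trans
          (Nat.mul_le_mul_right _ ((Finset.card_filter_le _ _).trans (hg X hXm))))
    · obtain ⟨hT, hTX, C, hC, hTC, hsX⟩ := (Finset.mem_bipartiteBelow _).1 hT
      have hTf := (h𝓑 T hT).1
      have hTQ : T ⊆ C ∩ X := Finset.subset_inter hTC hTX
      refine Finset.mem_biUnion.2 ⟨C ∩ X, ?_, Finset.mem_powersetCard.2 ⟨hTQ, hTf⟩⟩
      refine Finset.mem_filter.2 ⟨Finset.mem_filter.2 ⟨Finset.mem_image_of_mem _ hC, ?_⟩, ?_⟩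
      · exact (Finset.card_pos.1 (by omega)).mono hTQ
      · have := Finset.card_sdiff_add_card_inter X C
        rw [Finset.inter_comm X C] at this
        omega
    · rw [Finset.card_powersetCard]
      exact Nat.choose_le_choose _ (Finset.mem_filter.1 hQ).2
  rw [hdc] at hlow
  have hkey : (𝓑.card : ℝ) * (δ * ((n - f).choose (m - f) : ℝ)) ≤
      n.choose m * (g * (m - s).choose f) := hlow.trans (by exact_mod_cast hup)
  have hpow : (2 : ℝ) ^ s * ((m - s).choose f : ℝ) ≤ m.choose f := by
    exact_mod_cast two_pow_mul_choose_sub_le hf hm s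
  have hmul : (n.choose m : ℝ) * m.choose f = n.choose f * (n - f).choose (m - f) := by
    exact_mod_cast Nat.choose_mul hfm
  have hpos : (0 : ℝ) < ((n - f).choose (m - f) : ℝ) := by
    exact_mod_cast Nat.choose_pos (by omega)
  refine le_of_mul_le_mul_right ?_ hpos
  calc δ * 2 ^ s * (𝓑.card : ℝ) * ((n - f).choose (m - f) : ℝ)
      = 2 ^ s * ((𝓑.card : ℝ) * (δ * ((n - f).choose (m - f) : ℝ))) := by ring
    _ ≤ 2 ^ s * (n.choose m * (g * (m - s).choose f)) := by gcongr
    _ = n.choose m * g * (2 ^ s * (m - s).choose f) := by ring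
    _ ≤ n.choose m * g * m.choose f := by gcongr
    _ = g * (n.choose f : ℝ) * ((n - f).choose (m - f) : ℝ) := by linear_combination (g : ℝ) * hmul

end Sampling

section Components

variable {V : Type*} {E : V → V → Prop}

lemma ReachAvoid.trans {F : Finset V} {u v w : V} (h₁ : ReachAvoid E F u v)
    (h₂ : ReachAvoid E F v w) : ReachAvoid E F u w :=
  ⟨h₁.1, h₁.2.trans h₂.2⟩

lemma ReachAvoid.swap {F : Finset V} {u v : V} (h : ReachAvoid E F u v) :
    ReachAvoid (fun a b => E b a) F v u := by
  obtain ⟨hu, h⟩ := h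
  induction h with
  | refl => exact ⟨hu, .refl⟩
  | tail _ hbc ih => exact ⟨hbc.2, .head ⟨hbc.1, ih.1⟩ ih.2⟩

lemma reachesWithin_of_reachAvoid [Fintype V] {F R : Finset V} {v : V} (hv : v ∉ F)
    (hR : ∀ w, w ∈ R ↔ ReachAvoid E F v w) :
    ReachesWithin E v R ∧ outBoundary E R ⊆ F := by
  refine ⟨⟨(hR v).2 ⟨hv, .refl⟩, fun M hvM hM w hw => ?_⟩, fun b hb => ?_⟩
  · replace hw := ((hR w).1 hw).2
    induction hw with
    | refl => exact hvM
    | tail hab hbc ih => exact hM _ ih _ ((hR _).2 ⟨hv, hab.tail hbc⟩) hbc.1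
  · obtain ⟨hbR, a, ha, hab⟩ := mem_outBoundary.1 hb
    by_contra hbF
    exact hbR ((hR b).2 ⟨hv, ((hR a).1 ha).2.tail ⟨hab, hbF⟩⟩)

/-- `C` is empty or a strongly connected component after deleting at most `k` vertices. -/
def IsComponentAfterDeletion (E : V → V → Prop) (k : ℕ) (C : Finset V) : Prop :=
  ∃ F : Finset V, F.card ≤ k ∧
    ∀ v ∈ C, ∀ w, w ∈ C ↔ ReachAvoid E F v w ∧ ReachAvoid E F w v

lemma card_component_traces_le [Fintype V] [DecidableEq V] (k : ℕ) (X : Finset V)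
    (𝓠 : Finset (Finset V))
    (h𝓠 : ∀ Q ∈ 𝓠, Q.Nonempty ∧ ∃ C, IsComponentAfterDeletion E k C ∧ Q = C ∩ X) :
    𝓠.card ≤ X.card * ((X.powerset.filter fun Y => Y.card ≤ 2 * k).card * 4 ^ k) ^ 2 := by
  classical
  let traces : (V → V → Prop) → V → Finset (Finset V) := fun E v => X.powerset.filter fun Q =>
    ∃ R, ReachesWithin E v R ∧ (outBoundary E R).card ≤ k ∧ Q = R ∩ X
  have htr : ∀ E v, (traces E v).card ≤
      (X.powerset.filter fun Y => Y.card ≤ 2 * k).card * 4 ^ k :=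
    fun E v => card_reach_traces_le (E := E) v k X _ fun Q hQ => (Finset.mem_filter.1 hQ).2
  have hmem : ∀ (E : V → V → Prop) (F : Finset V) (v : V), F.card ≤ k → v ∉ F →
      (Finset.univ.filter fun w => ReachAvoid E F v w) ∩ X ∈ traces E v := by
    intro E F v hF hv
    obtain ⟨h1, h2⟩ := reachesWithin_of_reachAvoid (E := E)
      (R := Finset.univ.filter fun w => ReachAvoid E F v w) hv (by simp)
    exact Finset.mem_filter.2 ⟨Finset.mem_powerset.2 Finset.inter_subset_right, _, h1,
      (Finset.card_le_card h2).trans hF, rfl⟩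
  refine (Finset.card_le_card (t := X.biUnion fun v =>
    Finset.image₂ (· ∩ ·) (traces E v) (traces (fun a b => E b a) v)) fun Q hQ => ?_).trans
      (Finset.card_biUnion_le_card_mul _ _ _ fun v _ => ?_)
  · obtain ⟨⟨v, hvQ⟩, C, ⟨F, hF, hC⟩, rfl⟩ := h𝓠 Q hQ
    obtain ⟨hvC, hvX⟩ := Finset.mem_inter.1 hvQ
    have hvF : v ∉ F := ((hC v hvC v).1 hvC).1.1
    refine Finset.mem_biUnion.2 ⟨v, hvX, Finset.mem_image₂.2
      ⟨_, hmem E F v hF hvF, _, hmem (fun a b => E b a) F v hF hvF, ?_⟩⟩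
    ext w
    have hsw : ReachAvoid (fun a b => E b a) F v w ↔ ReachAvoid E F w v :=
      ⟨fun h => h.swap, fun h => h.swap⟩
    simp only [Finset.mem_inter, Finset.mem_filter, Finset.mem_univ, true_and, hsw, hC v hvC w]
    tauto
  · refine (Finset.card_image₂_le _ _ _).trans ?_
    rw [sq]
    exact Nat.mul_le_mul (htr _ _) (htr _ _)

/-- A nonempty set that is not a detection set lies in a component missing many vertices. -/
lemma exists_component_of_not_isDetSet [Fintype V] {ε : ℝ} {k : ℕ} {T : Finset V}
    (hT : T.Nonempty) (h : ¬ IsDetSet E ε k T) :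
    2 * ε * Fintype.card V ≤ Fintype.card V ∧
      ∃ C, IsComponentAfterDeletion E k C ∧ T ⊆ C ∧
        ∀ D : Finset V, (∀ w, w ∈ D ↔ w ∉ C) → ε * Fintype.card V ≤ D.card := by
  classical
  unfold IsDetSet at h
  push Not at h
  obtain ⟨F, hF, A, B, hAB, hdisj, hA, hB, hBA, hreach⟩ := h
  obtain ⟨v, hv⟩ := hT
  have hmemAB : ∀ w, w ∉ F → w ∈ A ∨ w ∈ B := fun w hw => by
    have : w ∈ A ∪ B := hAB ▸ hw
    exact this
  have hstay : ∀ b a, b ∈ B → ReachAvoid E F b a → a ∈ B := by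
    rintro b a hb ⟨-, h⟩
    induction h with
    | refl => exact hb
    | tail _ hcd ih =>
      exact (hmemAB _ hcd.2).resolve_left fun hd => hBA _ ih _ hd hcd.1
  constructor
  · have h1 : A.ncard + B.ncard ≤ Fintype.card V := by
      rw [← Set.ncard_union_eq hdisj, ← Nat.card_eq_fintype_card]
      exact Set.ncard_le_card _
    have h2 : (A.ncard : ℝ) + B.ncard ≤ Fintype.card V := by exact_mod_cast h1
    linarith
  refine ⟨Finset.univ.filter fun w => ReachAvoid E F v w ∧ ReachAvoid E F w v,
    ⟨F, hF, fun u hu w => ?_⟩, fun t ht => ?_, fun D hD => ?_⟩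
  · have hu := (Finset.mem_filter.1 hu).2
    simp only [Finset.mem_filter, Finset.mem_univ, true_and]
    exact ⟨fun h => ⟨hu.2.trans h.1, h.2.trans hu.1⟩, fun h => ⟨hu.1.trans h.1, h.2.trans hu.2⟩⟩
  · simpa using ⟨hreach v hv t ht, hreach t ht v hv⟩
  · have hcard : ∀ S : Set V, S ⊆ (D : Set V) → (S.ncard : ℝ) ≤ D.card := fun S hS => by
      rw [← Set.ncard_coe_finset D]
      exact_mod_cast Set.ncard_le_ncard hS
    simp only [Finset.mem_filter, Finset.mem_univ, true_and] at hD
    rcases hmemAB v (hreach v hv v hv).1 with hvA | hvB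
    · refine hB.trans (hcard B fun w hw => (hD w).2 fun h => ?_)
      exact Set.disjoint_left.1 hdisj hvA (hstay w v hw h.2)
    · refine hA.trans (hcard A fun w hw => (hD w).2 fun h => ?_)
      exact Set.disjoint_left.1 hdisj hw (hstay v w hvB h.1)

end Components

section Estimates

lemma card_small_subsets_mul_pow_le {α : Type*} (X : Finset α) (r : ℕ) {x : ℝ} (hx : 0 ≤ x)
    (hx1 : x ≤ 1) :
    ((X.powerset.filter fun Y => Y.card ≤ r).card : ℝ) * x ^ r ≤ Real.exp (x * X.card) := by
  calc ((X.powerset.filter fun Y => Y.card ≤ r).card : ℝ) * x ^ r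
      = ∑ Y ∈ X.powerset.filter fun Y => Y.card ≤ r, x ^ r := by
        rw [Finset.sum_const, nsmul_eq_mul]
    _ ≤ ∑ Y ∈ X.powerset.filter fun Y => Y.card ≤ r, x ^ Y.card := Finset.sum_le_sum
        fun Y hY => pow_le_pow_of_le_one hx hx1 (Finset.mem_filter.1 hY).2
    _ ≤ ∑ Y ∈ X.powerset, x ^ Y.card := Finset.sum_le_sum_of_subset_of_nonneg
        (Finset.filter_subset _ _) fun _ _ _ => by positivity
    _ = (x + 1) ^ X.card := by simpa using Finset.sum_pow_mul_eq_add_pow x 1 X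
    _ ≤ Real.exp x ^ X.card := by
        gcongr
        exact Real.add_one_le_exp x
    _ = Real.exp (x * X.card) := by rw [← Real.exp_nat_mul, mul_comm]

lemma component_traces_bound_le {α : Type*} (X : Finset α) {k : ℕ} (hk : 1 ≤ k) {y : ℝ}
    (hy : 2 ≤ y) (hX : (X.card : ℝ) ≤ 1024 * k * y ^ 2) :
    ((X.card * ((X.powerset.filter fun Y => Y.card ≤ 2 * k).card * 4 ^ k) ^ 2 : ℕ) : ℝ) ≤
      y ^ (67 * k) := by
  have hy1 : 1 ≤ y := by linarith
  set P := (X.powerset.filter fun Y => Y.card ≤ 2 * k).card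
  have h512 : (1 : ℝ) ≤ 512 * y ^ 2 := by nlinarith
  have h1 := card_small_subsets_mul_pow_le X (2 * k) (x := (512 * y ^ 2)⁻¹) (by positivity)
    (inv_le_one_of_one_le₀ h512)
  have hexp : Real.exp ((512 * y ^ 2)⁻¹ * X.card) ≤ 2 ^ (3 * k) := by
    have h2 : (512 * y ^ 2)⁻¹ * (X.card : ℝ) ≤ k * 2 := by
      rw [inv_mul_le_iff₀ (by positivity)]
      linarith
    have h3 : Real.exp 2 ≤ 2 ^ 3 := by
      have h4 := Real.exp_one_lt_d9
      have h5 : Real.exp 2 = Real.exp 1 * Real.exp 1 := by rw [← Real.exp_add]; norm_num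
      have := Real.exp_pos 1
      nlinarith
    calc _ ≤ Real.exp (k * 2) := Real.exp_le_exp.2 h2
      _ = Real.exp 2 ^ k := Real.exp_nat_mul _ _
      _ ≤ (2 ^ 3) ^ k := by gcongr
      _ = _ := by rw [pow_mul]
  have hPle : (P : ℝ) ≤ y ^ (25 * k) := by
    rw [inv_pow, ← div_eq_mul_inv, div_le_iff₀ (by positivity)] at h1
    calc (P : ℝ) ≤ 2 ^ (3 * k) * (512 * y ^ 2) ^ (2 * k) :=
          h1.trans (by gcongr)
      _ = 2 ^ (21 * k) * y ^ (4 * k) := by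
          rw [mul_pow, show (512 : ℝ) = 2 ^ 9 by norm_num, ← pow_mul, ← pow_mul, ← mul_assoc,
            ← pow_add]
          ring_nf
      _ ≤ y ^ (21 * k) * y ^ (4 * k) := by
          gcongr
      _ = _ := by rw [← pow_add]; ring_nf
  have hP4 : (P : ℝ) * 4 ^ k ≤ y ^ (27 * k) := by
    calc (P : ℝ) * 4 ^ k ≤ y ^ (25 * k) * (2 ^ 2) ^ k := by norm_num; gcongr
      _ = y ^ (25 * k) * 2 ^ (2 * k) := by rw [pow_mul 2 2 k]
      _ ≤ y ^ (25 * k) * y ^ (2 * k) := by gcongr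
      _ = _ := by rw [← pow_add]; ring_nf
  have hXle : (X.card : ℝ) ≤ y ^ (k + 12) := by
    have h2 : (k : ℝ) ≤ 2 ^ k := by exact_mod_cast Nat.lt_two_pow_self.le
    calc (X.card : ℝ) ≤ 1024 * 2 ^ k * y ^ 2 := hX.trans (by gcongr)
      _ = 2 ^ (k + 10) * y ^ 2 := by rw [pow_add, show (1024 : ℝ) = 2 ^ 10 by norm_num]; ring
      _ ≤ y ^ (k + 10) * y ^ 2 := by gcongr
      _ = _ := by rw [← pow_add]
  push_cast
  calc (X.card : ℝ) * (P * 4 ^ k) ^ 2 ≤ y ^ (k + 12) * (y ^ (27 * k)) ^ 2 := by gcongr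
    _ = y ^ (55 * k + 12) := by rw [← pow_mul, ← pow_add]; ring_nf
    _ ≤ y ^ (67 * k) := pow_le_pow_right₀ hy1 (by omega)

lemma pow_le_two_pow_of_log_le {y : ℝ} (hy : 2 ≤ y) {k s : ℕ} (hk : 1 ≤ k)
    (hs : 256 * k * Real.log y ≤ s) : 6 * y * y ^ (67 * k) ≤ 2 ^ s := by
  have hy0 : 0 < y := by linarith
  have hlog : 0 ≤ Real.log y := Real.log_nonneg (by linarith)
  calc 6 * y * y ^ (67 * k) ≤ y ^ 3 * y * y ^ (67 * k) := by
        gcongr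
        nlinarith [sq_nonneg (y - 2)]
    _ = y ^ (67 * k + 4) := by ring
    _ ≤ y ^ (71 * k) := pow_le_pow_right₀ (by linarith) (by omega)
    _ = Real.exp ((71 * k : ℕ) * Real.log y) := by
        rw [Real.exp_nat_mul, Real.exp_log hy0]
    _ ≤ Real.exp (s * Real.log 2) := by
        refine Real.exp_le_exp.2 ?_
        have h1 : (256 * k * Real.log y) * (1 / 2) ≤ s * Real.log 2 := by
          have := Real.log_two_gt_d9
          gcongr
          linarith
        have : 0 ≤ k * Real.log y := by positivity
        push_cast
        nlinarith
    _ = 2 ^ s := by rw [Real.exp_nat_mul, Real.exp_log two_pos]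

end Estimates

/-- At most a third of the `f`-sets fail to be detection sets. -/
lemma three_mul_card_not_isDetSet_le {V : Type*} [Fintype V] [DecidableEq V] {E : V → V → Prop}
    {ε : ℝ} {k f : ℕ} (hn : 1 ≤ Fintype.card V) (hε : ε ∈ Set.Ioo (0 : ℝ) 1) (hk : 0 < k)
    (hf : f = min ⌈512 * ((k : ℝ) / ε) * Real.log (1 / ε)⌉₊ (Fintype.card V))
    {𝓑 : Finset (Finset V)} (h𝓑 : ∀ T ∈ 𝓑, T.card = f ∧ ¬ IsDetSet E ε k T) :
    3 * (𝓑.card : ℝ) ≤ (Fintype.card V).choose f := by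
  classical
  obtain ⟨hε0, hε1⟩ := hε
  have hk0 : (0 : ℝ) < k := by exact_mod_cast hk
  have hn0 : (0 : ℝ) < Fintype.card V := by exact_mod_cast hn
  have hf1 : 1 ≤ f := by
    have hlog : 0 < Real.log (1 / ε) := Real.log_pos (one_lt_one_div hε0 hε1)
    have : 0 < ⌈512 * ((k : ℝ) / ε) * Real.log (1 / ε)⌉₊ := Nat.ceil_pos.2 (by positivity)
    omega
  have hcomp : ∀ T ∈ 𝓑, 2 * ε * Fintype.card V ≤ Fintype.card V ∧
      ∃ C, IsComponentAfterDeletion E k C ∧ T ⊆ C ∧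
        ε * Fintype.card V ≤ (Finset.univ \ C).card := by
    intro T hT
    obtain ⟨hTf, hTdet⟩ := h𝓑 T hT
    obtain ⟨h1, C, h2, h3, h4⟩ :=
      exists_component_of_not_isDetSet (Finset.card_pos.1 (by omega)) hTdet
    exact ⟨h1, C, h2, h3, h4 _ (by simp)⟩
  obtain rfl | ⟨T₀, hT₀⟩ := 𝓑.eq_empty_or_nonempty
  · simp
  obtain ⟨hε2, C₀, -, hTC₀, hC₀⟩ := hcomp T₀ hT₀
  replace hε2 : 2 * ε ≤ 1 := le_of_mul_le_mul_right (by linarith) hn0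
  have hfn : f < Fintype.card V := by
    refine lt_of_le_of_ne (by omega) fun h => ?_
    have hu : C₀ = Finset.univ := Finset.univ_subset_iff.1
      ((Finset.card_eq_iff_eq_univ T₀).1 ((h𝓑 T₀ hT₀).1.trans h) ▸ hTC₀)
    rw [hu] at hC₀
    simp only [sdiff_self, Finset.bot_eq_empty, Finset.card_empty, Nat.cast_zero] at hC₀
    have : 0 < ε * Fintype.card V := by positivity
    linarith
  have hfceil : f = ⌈512 * ((k : ℝ) / ε) * Real.log (1 / ε)⌉₊ := by omega
  set y := 1 / ε with hy
  have hεy : ε * y = 1 := mul_one_div_cancel hε0.ne'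
  have hy2 : 2 ≤ y := by rw [hy, le_div_iff₀ hε0]; exact hε2
  rw [show 512 * ((k : ℝ) / ε) = 512 * k * y by rw [hy]; ring] at hfceil
  have hlogy : Real.log y ≤ y - 1 := Real.log_le_sub_one_of_pos (by linarith)
  have hlogy0 : 0 ≤ Real.log y := Real.log_nonneg (by linarith)
  have hflow : 512 * k * y * Real.log y ≤ f := hfceil ▸ Nat.le_ceil _
  have hfup : (f : ℝ) ≤ 512 * k * y ^ 2 := by
    have h1 : (f : ℝ) < 512 * k * y * Real.log y + 1 :=
      hfceil ▸ Nat.ceil_lt_add_one (by positivity)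
    have h2 : 512 * k * y * Real.log y ≤ 512 * k * y * (y - 1) := by gcongr
    have h3 : (1 : ℝ) ≤ k := by exact_mod_cast hk
    nlinarith
  set s := ⌈ε * f / 2⌉₊ with hs
  have hsup : (s : ℝ) ≤ ε * f / 2 + 1 := (Nat.ceil_lt_add_one (by positivity)).le
  have hslow : 256 * k * Real.log y ≤ s := by
    refine le_trans ?_ (Nat.le_ceil _)
    have := mul_le_mul_of_nonneg_left hflow hε0.le
    rw [show ε * (512 * k * y * Real.log y) = (ε * y) * (512 * k * Real.log y) by ring, hεy] at this
    linarith
  have hmain := card_bad_le (V := V) (𝓢 := Finset.univ.filter (IsComponentAfterDeletion E k))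
    (𝓑 := 𝓑) (f := f) (m := min (2 * f) (Fintype.card V)) (s := s) (g := ⌊y ^ (67 * k)⌋₊)
    (δ := ε / 2) hf1 (by omega) (by omega) (by omega) ?_ ?_
  · have h6 := pow_le_two_pow_of_log_le hy2 hk hslow
    have hg : ((⌊y ^ (67 * k)⌋₊ : ℕ) : ℝ) ≤ y ^ (67 * k) := Nat.floor_le (by positivity)
    have hYpos : (0 : ℝ) < y ^ (67 * k) := by positivity
    refine le_of_mul_le_mul_left ?_ hYpos
    calc y ^ (67 * k) * (3 * (𝓑.card : ℝ))
        = ε / 2 * (6 * y * y ^ (67 * k)) * 𝓑.card := by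
          linear_combination (-3 * y ^ (67 * k) * (𝓑.card : ℝ)) * hεy
      _ ≤ ε / 2 * 2 ^ s * 𝓑.card := by gcongr
      _ ≤ _ := hmain
      _ ≤ _ := by gcongr
  · intro T hT
    have hTf := (h𝓑 T hT).1
    obtain ⟨-, C, hC, hTC, hlarge⟩ := hcomp T hT
    refine ⟨hTf, C, by simpa using hC, hTC, ?_⟩
    rcases le_total (Fintype.card V) (2 * f) with hle | hle
    · rw [min_eq_right hle, Nat.choose_self, Nat.cast_one, mul_one]
      have hpos : 1 ≤ ((Finset.powersetCard (Fintype.card V) Finset.univ).filter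
          fun X => T ⊆ X ∧ s ≤ (X \ C).card).card := by
        refine Finset.card_pos.2 ⟨Finset.univ, Finset.mem_filter.2 ⟨?_, by simp, ?_⟩⟩
        · exact Finset.mem_powersetCard.2 ⟨subset_rfl, Finset.card_univ⟩
        · refine Nat.ceil_le.2 (le_trans ?_ hlarge)
          have : ε * f ≤ ε * Fintype.card V := by gcongr
          have : 0 ≤ ε * f := by positivity
          linarith
      exact le_trans (by linarith) (Nat.one_le_cast.2 hpos)
    · rw [min_eq_left hle, show 2 * f - f = f by omega]
      have hU : (Finset.univ \ T).card = Fintype.card V - f := by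
        rw [Finset.card_sdiff_of_subset (Finset.subset_univ _), Finset.card_univ, hTf]
      rw [← hU]
      refine (half_mul_choose_le_card (B := Finset.univ \ C) (s := s)
        (Finset.sdiff_subset_sdiff subset_rfl hTC) hε0.le ?_ hf1 hsup).trans
          (Nat.cast_le.2 (Finset.card_le_card_of_injOn (fun Y => Y ∪ T) ?_ ?_))
      · refine le_trans ?_ hlarge
        rw [hU]
        gcongr
        exact Nat.sub_le _ _
      · intro Y hY
        obtain ⟨hY, hYs⟩ := Finset.mem_filter.1 hY
        obtain ⟨hYU, hYf⟩ := Finset.mem_powersetCard.1 hY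
        refine Finset.mem_filter.2 ⟨Finset.mem_powersetCard.2 ⟨Finset.subset_univ _, ?_⟩,
          Finset.subset_union_right, hYs.trans (Finset.card_le_card fun b hb => ?_)⟩
        · rw [Finset.card_union_of_disjoint
            (Finset.disjoint_of_subset_left hYU Finset.sdiff_disjoint), hYf, hTf, two_mul]
        · grind
      · intro Y hY Y' hY' h
        have h1 := (Finset.mem_powersetCard.1 (Finset.mem_filter.1 hY).1).1
        have h2 := (Finset.mem_powersetCard.1 (Finset.mem_filter.1 hY').1).1
        rw [← Finset.union_sdiff_cancel_right
            (Finset.disjoint_of_subset_left h1 Finset.sdiff_disjoint),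
          ← Finset.union_sdiff_cancel_right
            (Finset.disjoint_of_subset_left h2 Finset.sdiff_disjoint)]
        exact congrArg (· \ T) h
  · intro X hX
    refine Nat.le_floor ((Nat.cast_le.2 (card_component_traces_le (E := E) k X _ ?_)).trans
      (component_traces_bound_le X hk hy2 ?_))
    · intro Q hQ
      obtain ⟨hQ, hne⟩ := Finset.mem_filter.1 hQ
      obtain ⟨C, hC, rfl⟩ := Finset.mem_image.1 hQ
      exact ⟨hne, C, (Finset.mem_filter.1 hC).2, rfl⟩
    · have h1 : X.card ≤ 2 * f := by omega
      have h2 : (X.card : ℝ) ≤ 2 * f := by exact_mod_cast h1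
      linarith

/-- there is an absolute constant `c₀ > 0` such that for every digraph on
`n ≥ 1` vertices, `ε ∈ (0,1)` and `k ≥ 1`, with `f = min(⌈c₀·(k/ε)·ln(1/ε)⌉, n)`,
at least a `2/3` fraction of the `f`-element subsets of `V(G)` are `(ε,k)` detection
sets; in particular an `(ε,k)` detection set of size `f` exists. -/
theorem random_detection_set :
    ∃ c₀ : ℝ, 0 < c₀ ∧
      ∀ (V : Type) [Fintype V] [DecidableEq V] (E : V → V → Prop) (ε : ℝ) (k : ℕ),
        1 ≤ Fintype.card V → ε ∈ Set.Ioo (0 : ℝ) 1 → 0 < k →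
        ∀ f : ℕ, f = min ⌈c₀ * ((k : ℝ) / ε) * Real.log (1 / ε)⌉₊ (Fintype.card V) →
          (2 / 3 : ℝ) * ((Fintype.card V).choose f : ℝ) ≤
            ({T : Finset V | T.card = f ∧ IsDetSet E ε k T}.ncard : ℝ) ∧
          ∃ T : Finset V, T.card = f ∧ IsDetSet E ε k T := by
  classical
  refine ⟨512, by norm_num, fun V _ _ E ε k hn hε hk f hf => ?_⟩
  have hset : {T : Finset V | T.card = f ∧ IsDetSet E ε k T} =
      ((Finset.powersetCard f Finset.univ).filter (IsDetSet E ε k) : Finset (Finset V)) := by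
    ext T
    simp
  have hbad := three_mul_card_not_isDetSet_le (E := E) hn hε hk hf
    (𝓑 := (Finset.powersetCard f Finset.univ).filter fun T => ¬ IsDetSet E ε k T)
    fun T hT => by simpa using hT
  have hsum := Finset.card_filter_add_card_filter_not
    (s := Finset.powersetCard f (Finset.univ : Finset V)) (IsDetSet E ε k)
  rw [Finset.card_powersetCard, Finset.card_univ] at hsum
  have hsum' : (((Finset.powersetCard f Finset.univ).filter (IsDetSet E ε k)).card : ℝ) +
      ((Finset.powersetCard f Finset.univ).filter fun T => ¬ IsDetSet E ε k T).card =
        (Fintype.card V).choose f := by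
    exact_mod_cast hsum
  have hpos : (0 : ℝ) < (Fintype.card V).choose f := by
    exact_mod_cast Nat.choose_pos (by omega)
  rw [hset, Set.ncard_coe_finset]
  refine ⟨by linarith, ?_⟩
  have hcard : 0 < ((Finset.powersetCard f Finset.univ).filter (IsDetSet E ε k)).card := by
    have : (0 : ℝ) < ((Finset.powersetCard f Finset.univ).filter (IsDetSet E ε k)).card := by
      linarith
    exact_mod_cast this
  obtain ⟨T, hT⟩ := Finset.card_pos.1 hcard
  exact ⟨T, by simpa using hT⟩
end

section
/- Let G be a digraph, let s ∈ V(G), let T' ⊆ V(G) with s ∉ T', and let k be a positive integer. Suppose there exists a set X ⊆ V(G) with |X| ≤ k such that P := R_{{s}}(X) ∩ T' is the set of vertices of T' reachable from s in G∖X. Then there exists an important s-(T'∖P) separator X' with |X'| ≤ k such that R_{{s}}(X') ∩ T' = P. -/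
theorem RSet_anti {V : Type*} (E : V → V → Prop) (S : Finset V) {X Y : Finset V} (h : X ⊆ Y) :
    RSet E S Y ⊆ RSet E S X := by
  rintro v ⟨s, hs, hsY, hv⟩
  exact ⟨s, hs, fun hx => hsY (h hx), Relation.ReflTransGen.mono (fun a b hab => ⟨hab.1, fun hx => hab.2 (h hx)⟩) _ _ hv⟩

/-- Every separator `X` is dominated by an important one: no larger, and reaching at least
as much from `A`. -/
theorem IsSep.exists_isImpSep {V : Type*} [Fintype V] [DecidableEq V] {E : V → V → Prop}
    {A B X : Finset V} (hX : IsSep E A B X) :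
    ∃ Y : Finset V, Y.card ≤ X.card ∧ IsImpSep E A B Y ∧ RSet E A X ⊆ RSet E A Y := by
  obtain ⟨M, ⟨hMsep, hMcard, hMR⟩, hMmax⟩ := Set.exists_max_image
    {Y : Finset V | IsSep E A B Y ∧ Y.card ≤ X.card ∧ RSet E A X ⊆ RSet E A Y}
    (fun Y => (RSet E A Y).ncard) (Set.toFinite _) ⟨X, hX, le_rfl, subset_rfl⟩
  have hmax : ∀ Z, IsSep E A B Z → Z.card ≤ X.card → ¬ RSet E A M ⊂ RSet E A Z :=
    fun Z hZ hc hlt => absurd (hMmax Z ⟨hZ, hc, hMR.trans hlt.subset⟩)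
      (not_le.2 (Set.ncard_lt_ncard hlt (Set.toFinite _)))
  obtain ⟨Y, ⟨hYsep, hYR⟩, hYmin⟩ := Set.exists_min_image
    {Y : Finset V | IsSep E A B Y ∧ RSet E A Y = RSet E A M}
    Finset.card (Set.toFinite _) ⟨M, hMsep, rfl⟩
  have hYcard : Y.card ≤ X.card := (hYmin M ⟨hMsep, rfl⟩).trans hMcard
  refine ⟨Y, hYcard, ⟨⟨hYsep, fun v hv hsep => ?_⟩, ?_⟩, hYR ▸ hMR⟩
  · have hsub : RSet E A M ⊆ RSet E A (Y.erase v) := hYR ▸ RSet_anti E A (Y.erase_subset v)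
    have hlt := Finset.card_erase_lt_of_mem hv
    have heq : RSet E A M = RSet E A (Y.erase v) := by
      by_contra hne
      exact hmax _ hsep (hlt.le.trans hYcard) (hsub.ssubset_of_ne hne)
    exact absurd (hYmin _ ⟨hsep, heq.symm⟩) (not_le.2 hlt)
  · rintro ⟨Z, hZ, hc, hlt⟩
    exact hmax Z hZ (hc.trans hYcard) (hYR ▸ hlt)

/-- if deleting some `X` with `|X| ≤ k` leaves exactly `P ⊆ T'` reachable
from `s`, then there is an important `s`-`(T'∖P)` separator `X'` with `|X'| ≤ k` leaving
exactly `P` reachable from `s` within `T'`. -/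
theorem reachability_via_important_separator
    (V : Type*) [Fintype V] [DecidableEq V] (E : V → V → Prop)
    (s : V) (T' : Finset V) (hs : s ∉ T') (k : ℕ) (hk : 0 < k)
    (X : Finset V) (hXk : X.card ≤ k)
    (P : Finset V) (hP : ↑P = RSet E {s} X ∩ ↑T') :
    ∃ X' : Finset V, X'.card ≤ k ∧ IsImpSep E {s} (T' \ P) X' ∧
      RSet E {s} X' ∩ ↑T' = ↑P := by
  have hmem : ∀ v, v ∈ P ↔ v ∈ RSet E {s} X ∧ v ∈ T' := fun v => by
    simpa using Set.ext_iff.1 hP v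
  have hX : IsSep E {s} (T' \ P) X := fun b hb hR =>
    (Finset.mem_sdiff.1 hb).2 ((hmem b).2 ⟨hR, (Finset.mem_sdiff.1 hb).1⟩)
  obtain ⟨Y, hc, hY, hR⟩ := hX.exists_isImpSep
  refine ⟨Y, hc.trans hXk, hY, Set.Subset.antisymm ?_ ?_⟩
  · rintro v ⟨hv, hvT⟩
    by_contra hvP
    exact hY.1.1 v (Finset.mem_sdiff.2 ⟨hvT, hvP⟩) hv
  · intro v hv
    exact ⟨hR ((hmem v).1 hv).1, ((hmem v).1 hv).2⟩
end
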